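/- arXiv:2008.13079 — 3 statements merged into one kernel-verified Lean document; each statement's English description precedes it below -/
import Mathlib

section
/- Let f ∈ ℋ and h > 0. Then for every s ∈ ℂ the series (B_h f_s)(t) = Σ_{n=0}^∞ (−1)^n (Δ_h^n f_s)(t)/(n+1) and (E^h f_s)(t) = Σ_{n=0}^∞ binom(h,n) (Δ^n f_s)(t) converge absolutely and locally uniformly on (0,∞), and the functions (s,t) ↦ (B_h f_s)(t) and (s,t) ↦ (E^h f_s)(t) again belong to ℋ. -/
open MeasureTheory Filter Set

noncomputable section

/-- The Laplace transform `ℒ(φ)(t) = ∫₀^∞ e^{−tu} φ(u) du`. -/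
def Lap (φ : ℝ → ℂ) (t : ℝ) : ℂ :=
  ∫ u in Ioi (0:ℝ), Complex.exp (-(t * u : ℝ)) * φ u

/-- Membership in the domain `𝒟(ℒ)` of the Laplace transform:
measurable, integrable on `(0,R)` for all `R > 0`, and
`∫₀^∞ e^{−xu} |φ(u)| du < ∞` for every `x > 0`. -/
def MemDL (φ : ℝ → ℂ) : Prop :=
  Measurable φ ∧
  (∀ R > 0, IntegrableOn φ (Ioo 0 R)) ∧
  (∀ x > 0, IntegrableOn (fun u => Real.exp (-(x * u)) * ‖φ u‖) (Ioi 0))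

/-- The forward difference operator with step `h`: `(Δ_h f)(t) = f(t+h) − f(t)`. -/
def Dh (h : ℝ) (f : ℝ → ℂ) : ℝ → ℂ := fun t => f (t + h) - f t

/-- The `n`-th term of the Bernoulli-operator series: `(−1)^n (Δ_h^n f)(t)/(n+1)`. -/
def BTerm (h : ℝ) (f : ℝ → ℂ) (n : ℕ) (t : ℝ) : ℂ :=
  ((-1 : ℂ) ^ n / (n + 1)) * (Dh h)^[n] f t

/-- The Bernoulli operator `(B_h f)(t) = Σ_{n≥0} (−1)^n (Δ_h^n f)(t)/(n+1)`. -/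
def Bop (h : ℝ) (f : ℝ → ℂ) (t : ℝ) : ℂ := ∑' n : ℕ, BTerm h f n t

/-- Generalized binomial coefficient `binom(h,n) = h(h−1)⋯(h−n+1)/n!`. -/
def gbinom (h : ℝ) (n : ℕ) : ℝ :=
  (∏ i ∈ Finset.range n, (h - i)) / n.factorial

/-- The `n`-th term of the Newton series: `binom(h,n) (Δ^n f)(t)`. -/
def NTerm (h : ℝ) (f : ℝ → ℂ) (n : ℕ) (t : ℝ) : ℂ :=
  (gbinom h n : ℂ) * (Dh 1)^[n] f t

/-- The fractional shift `(E^h f)(t) = Σ_{n≥0} binom(h,n) (Δ^n f)(t)`. -/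
def Nop (h : ℝ) (f : ℝ → ℂ) (t : ℝ) : ℂ := ∑' n : ℕ, NTerm h f n t

/-- The series `Σ g n` converges absolutely (pointwise on `S`) and its partial sums
converge locally uniformly on `S`. -/
def ALUOn (g : ℕ → ℝ → ℂ) (S : Set ℝ) : Prop :=
  (∀ t ∈ S, Summable fun n : ℕ => ‖g n t‖) ∧
  TendstoLocallyUniformlyOn (fun N t => ∑ n ∈ Finset.range N, g n t)
    (fun t => ∑' n : ℕ, g n t) atTop S

/-- The Laplace–Mellin transform `f_{−s}(t) = (1/Γ(s)) ∫₀^∞ e^{−tu} φ(u) u^{s−1} du`. -/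
def LM (φ : ℝ → ℂ) (s : ℂ) (t : ℝ) : ℂ :=
  (1 / Complex.Gamma s) *
    ∫ u in Ioi (0:ℝ), Complex.exp (-(t * u : ℝ)) * φ u * (u : ℂ) ^ (s - 1)

/-- `φ(u) = o(u^γ)` as `u → 0⁺`, i.e. `|φ(u)| u^{−Re γ} → 0`. -/
def SmallO (φ : ℝ → ℂ) (γ : ℂ) : Prop :=
  Tendsto (fun u : ℝ => ‖φ u‖ * u ^ (-γ.re)) (nhdsWithin 0 (Ioi 0)) (nhds 0)

/-- Membership in `𝒟^ι(ℒ)`: `φ ∈ 𝒟(ℒ)` dominated by a nondecreasing `ψ ∈ 𝒟(ℒ)`. -/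
def MemDLi (φ : ℝ → ℂ) : Prop :=
  MemDL φ ∧ ∃ ψ : ℝ → ℝ, MemDL (fun u => (ψ u : ℂ)) ∧ MonotoneOn ψ (Ioi 0) ∧
    ∀ u ∈ Ioi (0:ℝ), ‖φ u‖ ≤ ψ u

/-- Membership in the class `ℋ`, with the witness `φ` recorded:
(1) `t ↦ f(s,t)` differentiable on `(0,∞)`;
(2) `s ↦ f(s,t)` and `s ↦ ∂ₜf(s,t)` entire;
(3) `f(−1,·) = ℒ(φ)` with `φ ∈ 𝒟^ι(ℒ)`;
(4) `f(−s,t)` is the Laplace–Mellin transform of `φ` for `Re s > 1`. -/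
def MemHwith (f : ℂ → ℝ → ℂ) (φ : ℝ → ℂ) : Prop :=
  (∀ s : ℂ, ∀ t ∈ Ioi (0:ℝ), DifferentiableAt ℝ (f s) t) ∧
  (∀ t ∈ Ioi (0:ℝ), Differentiable ℂ fun s => f s t) ∧
  (∀ t ∈ Ioi (0:ℝ), Differentiable ℂ fun s => deriv (f s) t) ∧
  MemDLi φ ∧
  (∀ t ∈ Ioi (0:ℝ), f (-1) t = Lap φ t) ∧
  (∀ s : ℂ, 1 < s.re → ∀ t ∈ Ioi (0:ℝ), f (-s) t = LM φ s t)

/-- Membership in the class `ℋ`. -/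
def MemH (f : ℂ → ℝ → ℂ) : Prop := ∃ φ : ℝ → ℂ, MemHwith f φ

/-- The Hurwitz zeta function `ζ(s,x)` for real `x > 0`: the meromorphic continuation in `s`
of `Σ_{k≥0} (k+x)^{−s}`, expressed via Mathlib's `HurwitzZeta.hurwitzZeta` on `ℝ/ℤ`. -/
def hurwitz (s : ℂ) (x : ℝ) : ℂ :=
  HurwitzZeta.hurwitzZeta (↑x : UnitAddCircle) s -
    ∑ k ∈ Finset.range ⌊x⌋₊,
      (if (k : ℝ) + Int.fract x = 0 then 0
       else (((k : ℝ) + Int.fract x : ℝ) : ℂ) ^ (-s))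

end

/-- `χ` is measurable and, on `(0,∞)`, of order `u^N e^{xu}` for every `x > 0`. -/
def IsSubexp (N : ℕ) (χ : ℝ → ℂ) : Prop :=
  Measurable χ ∧ ∀ x > 0, ∃ C : ℝ, ∀ u > 0, ‖χ u‖ ≤ C * (u ^ N * Real.exp (x * u))

/-- The integrand of the Laplace–Mellin transform. -/
noncomputable def lmKernel (χ : ℝ → ℂ) (s : ℂ) (t u : ℝ) : ℂ :=
  Complex.exp (-(t * u : ℝ)) * χ u * (u : ℂ) ^ (s - 1)

theorem LM_eq_lmKernel (χ : ℝ → ℂ) (s : ℂ) (t : ℝ) :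
    LM χ s t = (Complex.Gamma s)⁻¹ * ∫ u in Ioi (0:ℝ), lmKernel χ s t u := by
  simp [LM, lmKernel]

theorem Lap_eq_LM (χ : ℝ → ℂ) (t : ℝ) : Lap χ t = LM χ 1 t := by
  simp [LM, Lap]

theorem lmKernel_mul (χ v : ℝ → ℂ) (s : ℂ) (t u : ℝ) :
    lmKernel (fun u => χ u * v u) s t u = v u * lmKernel χ s t u := by
  simp only [lmKernel]; ring

theorem norm_lmKernel (χ : ℝ → ℂ) (s : ℂ) (t : ℝ) {u : ℝ} (hu : 0 < u) :
    ‖lmKernel χ s t u‖ = Real.exp (-(t * u)) * ‖χ u‖ * u ^ (s.re - 1) := by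
  rw [lmKernel, norm_mul, norm_mul, Complex.norm_cpow_eq_rpow_re_of_pos hu, ← Complex.ofReal_neg,
    Complex.norm_exp_ofReal]
  simp

theorem norm_lmKernel_anti (χ : ℝ → ℂ) (s : ℂ) {τ t u : ℝ} (h : τ ≤ t) (hu : 0 < u) :
    ‖lmKernel χ s t u‖ ≤ ‖lmKernel χ s τ u‖ := by
  rw [norm_lmKernel _ _ _ hu, norm_lmKernel _ _ _ hu]
  gcongr

theorem Measurable.lmKernel {χ : ℝ → ℂ} (hχ : Measurable χ) (s : ℂ) (t : ℝ) :
    Measurable (lmKernel χ s t) := by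
  unfold _root_.lmKernel
  fun_prop

theorem one_add_le_mul_exp {x u : ℝ} (hx : 0 < x) (hu : 0 < u) :
    1 + u ≤ (1 + 1 / x) * Real.exp (x * u) := by
  have h1 := Real.add_one_le_exp (x * u)
  have h2 : (1 + 1 / x) * (x * u + 1) ≤ (1 + 1 / x) * Real.exp (x * u) := by gcongr
  have h3 : (1 + 1 / x) * (x * u + 1) = 1 + u + x * u + 1 / x := by field_simp; ring
  have : 0 < x * u := by positivity
  have : 0 < 1 / x := by positivity
  linarith

theorem integrableOn_rpow_mul_exp {r b : ℝ} (hr : -1 < r) (hb : 0 < b) :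
    IntegrableOn (fun u : ℝ => u ^ r * Real.exp (-(b * u))) (Ioi 0) := by
  simpa [neg_mul] using integrableOn_rpow_mul_exp_neg_mul_rpow hr zero_lt_one hb

namespace IsSubexp

variable {M N : ℕ} {χ v : ℝ → ℂ}

theorem mul_weight (hχ : IsSubexp M χ) (hv : Measurable v) {A : ℝ}
    (hA : ∀ u > 0, ‖v u‖ ≤ A * ((1 + u) * u ^ N)) :
    IsSubexp (M + N) (fun u => χ u * v u) := by
  refine ⟨hχ.1.mul hv, fun x hx => ?_⟩
  obtain ⟨C, hC⟩ := hχ.2 (x / 2) (by positivity)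
  have hA0 : 0 ≤ A := by
    have := (norm_nonneg _).trans (hA 1 one_pos)
    norm_num at this; linarith
  have hC0 : 0 ≤ C := by
    have := (norm_nonneg _).trans (hC 1 one_pos)
    exact nonneg_of_mul_nonneg_left this (by positivity)
  refine ⟨C * A * (1 + 1 / (x / 2)), fun u hu => ?_⟩
  rw [norm_mul]
  calc ‖χ u‖ * ‖v u‖
      ≤ (C * (u ^ M * Real.exp (x / 2 * u))) *
        (A * (((1 + 1 / (x / 2)) * Real.exp (x / 2 * u)) * u ^ N)) := by
        refine mul_le_mul (hC u hu) ((hA u hu).trans ?_) (norm_nonneg _) (by positivity)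
        gcongr
        exact one_add_le_mul_exp (by positivity) hu
    _ = _ := by
        have : Real.exp (x * u) = Real.exp (x / 2 * u) * Real.exp (x / 2 * u) := by
          rw [← Real.exp_add]; ring_nf
        rw [this, pow_add]; ring

theorem mul_id (hχ : IsSubexp N χ) : IsSubexp (N + 1) (fun u => χ u * (u : ℂ)) := by
  refine hχ.mul_weight (A := 1) (by fun_prop) fun u hu => ?_
  simp only [Complex.norm_real, Real.norm_eq_abs, abs_of_pos hu]
  nlinarith

theorem exists_norm_lmKernel_le (hχ : IsSubexp N χ) (s : ℂ) {t : ℝ} (ht : 0 < t) :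
    ∃ C : ℝ, ∀ u > 0, ‖lmKernel χ s t u‖ ≤
      C * (u ^ (N + s.re - 1 : ℝ) * Real.exp (-(t / 2 * u))) := by
  obtain ⟨C, hC⟩ := hχ.2 (t / 2) (by positivity)
  refine ⟨C, fun u hu => ?_⟩
  rw [norm_lmKernel _ _ _ hu]
  calc _ ≤ Real.exp (-(t * u)) * (C * (u ^ N * Real.exp (t / 2 * u))) * u ^ (s.re - 1) := by
        gcongr; exact hC u hu
    _ = _ := by
        have h1 : Real.exp (-(t / 2 * u)) = Real.exp (-(t * u)) * Real.exp (t / 2 * u) := by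
          rw [← Real.exp_add]; ring_nf
        have h2 : u ^ (N + s.re - 1 : ℝ) = u ^ N * u ^ (s.re - 1) := by
          rw [add_sub_assoc, Real.rpow_add hu, Real.rpow_natCast]
        rw [h1, h2]; ring

theorem integrableOn_lmKernel (hχ : IsSubexp N χ) {s : ℂ} (hs : -(N : ℝ) < s.re) {t : ℝ}
    (ht : 0 < t) : IntegrableOn (lmKernel χ s t) (Ioi 0) := by
  obtain ⟨C, hC⟩ := hχ.exists_norm_lmKernel_le s ht
  refine ((integrableOn_rpow_mul_exp (r := N + s.re - 1) (by linarith)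
    (half_pos ht)).const_mul C).mono' (hχ.1.lmKernel s t).aestronglyMeasurable ?_
  filter_upwards [ae_restrict_mem measurableSet_Ioi] with u hu using hC u hu

theorem differentiableAt_integral_lmKernel (hχ : IsSubexp N χ) {s : ℂ} (hs : -(N : ℝ) < s.re)
    {t : ℝ} (ht : 0 < t) :
    DifferentiableAt ℂ (fun s => ∫ u in Ioi (0:ℝ), lmKernel χ s t u) s := by
  set F : ℝ → ℂ := fun u => Complex.exp (-(t * u : ℝ)) * χ u with hF
  have hmellin : (fun s => ∫ u in Ioi (0:ℝ), lmKernel χ s t u) = mellin F := by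
    ext s
    simp only [mellin, lmKernel, hF, smul_eq_mul]
    exact integral_congr_ae (Eventually.of_forall fun u => by ring)
  have hF1 : F = lmKernel χ 1 t := by ext u; simp [lmKernel, hF]
  obtain ⟨C, hC⟩ := hχ.exists_norm_lmKernel_le 1 ht
  rw [← hF1] at hC
  have hC' : ∀ u > 0, ‖F u‖ ≤ C * (u ^ N * Real.exp (-(t / 2 * u))) := by
    intro u hu
    simpa using hC u hu
  have hC0 : 0 ≤ C := by
    have := (norm_nonneg _).trans (hC' 1 one_pos)
    exact nonneg_of_mul_nonneg_left this (by positivity)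
  rw [hmellin]
  refine mellin_differentiableAt_of_isBigO_rpow_exp (a := t / 4) (b := -N) (by positivity)
    ?_ ?_ ?_ hs
  · rw [hF1]
    exact (hχ.integrableOn_lmKernel (by rw [Complex.one_re]; linarith [N.cast_nonneg (α := ℝ)])
      ht).locallyIntegrableOn
  · have h1 : F =O[atTop] fun u => u ^ N * Real.exp (-(t / 2 * u)) := by
      refine Asymptotics.IsBigO.of_bound C ?_
      filter_upwards [eventually_gt_atTop 0] with u hu
      rw [Real.norm_of_nonneg (by positivity)]
      exact hC' u hu
    refine h1.trans ?_
    have h2 := (isLittleO_pow_exp_pos_mul_atTop (k := N) (b := t / 4) (by positivity)).isBigO.mul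
      (Asymptotics.isBigO_refl (fun u => Real.exp (-(t / 2 * u))) atTop)
    refine h2.congr_right fun u => ?_
    rw [← Real.exp_add]; ring_nf
  · refine Asymptotics.IsBigO.of_bound C ?_
    filter_upwards [self_mem_nhdsWithin] with u hu
    have hu' : 0 < u := hu
    rw [neg_neg, Real.rpow_natCast, Real.norm_of_nonneg (by positivity)]
    refine (hC' u hu).trans ?_
    gcongr
    refine mul_le_of_le_one_right (by positivity) (Real.exp_le_one_iff.2 ?_)
    have : 0 < t / 2 * u := by positivity
    linarith

theorem differentiableAt_LM (hχ : IsSubexp N χ) {s : ℂ} (hs : -(N : ℝ) < s.re)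
    {t : ℝ} (ht : 0 < t) : DifferentiableAt ℂ (fun s => LM χ s t) s := by
  simp only [LM_eq_lmKernel]
  exact (Complex.differentiable_one_div_Gamma s).mul (hχ.differentiableAt_integral_lmKernel hs ht)

theorem hasDerivAt_LM (hχ : IsSubexp N χ) {s : ℂ} (hs : -(N : ℝ) < s.re) {t : ℝ} (ht : 0 < t) :
    HasDerivAt (LM χ s) (-LM (fun u => χ u * (u : ℂ)) s t) t := by
  have hs' : -((N + 1 : ℕ) : ℝ) < s.re := by push_cast; linarith
  have key := (hasDerivAt_integral_of_dominated_loc_of_deriv_le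
    (μ := volume.restrict (Ioi (0:ℝ))) (F := fun t u => lmKernel χ s t u)
    (F' := fun t u => -lmKernel (fun u => χ u * (u : ℂ)) s t u) (x₀ := t) (s := Ioi (t / 2))
    (bound := fun u => ‖lmKernel (fun u => χ u * (u : ℂ)) s (t / 2) u‖)
    (Ioi_mem_nhds (by linarith))
    (Eventually.of_forall fun x => (hχ.1.lmKernel s x).aestronglyMeasurable)
    (hχ.integrableOn_lmKernel hs ht)
    (hχ.mul_id.1.lmKernel s t).neg.aestronglyMeasurable ?_
    (hχ.mul_id.integrableOn_lmKernel hs' (half_pos ht)).norm ?_).2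
  · rw [integral_neg] at key
    have := key.const_mul ((Complex.Gamma s)⁻¹)
    rw [mul_neg, ← LM_eq_lmKernel] at this
    exact this.congr_of_eventuallyEq (Eventually.of_forall fun x => LM_eq_lmKernel χ s x)
  · filter_upwards [ae_restrict_mem measurableSet_Ioi] with u hu x hx
    rw [norm_neg]
    exact norm_lmKernel_anti _ _ (le_of_lt hx) hu
  · refine Eventually.of_forall fun u x _ => ?_
    have h1 : HasDerivAt (fun x : ℝ => Complex.exp (-(x * u : ℝ)))
        (Complex.exp (-(x * u : ℝ)) * (-(u : ℂ))) x := by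
      have h0 : HasDerivAt (fun x : ℝ => (-((x * u : ℝ) : ℂ))) (-(u : ℂ)) x := by
        have := ((hasDerivAt_id x).mul_const u).ofReal_comp.fun_neg
        simpa using this
      exact h0.cexp
    have h2 := (h1.mul_const (χ u)).mul_const ((u : ℂ) ^ (s - 1))
    refine h2.congr_deriv ?_
    simp only [lmKernel]; ring

end IsSubexp

/-- The regularity required of members of `ℋ`, for `s` restricted to `U`. -/
def IsRegularOn (U : Set ℂ) (G : ℂ → ℝ → ℂ) : Prop :=
  ∀ t > 0, (∀ s ∈ U, DifferentiableAt ℝ (G s) t) ∧ DifferentiableOn ℂ (fun s => G s t) U ∧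
    DifferentiableOn ℂ (fun s => deriv (G s) t) U

namespace IsRegularOn

variable {U V : Set ℂ} {F G : ℂ → ℝ → ℂ}

theorem mono (hG : IsRegularOn V G) (h : U ⊆ V) : IsRegularOn U G := fun t ht =>
  ⟨fun s hs => (hG t ht).1 s (h hs), (hG t ht).2.1.mono h, (hG t ht).2.2.mono h⟩

theorem add (hF : IsRegularOn U F) (hG : IsRegularOn U G) :
    IsRegularOn U (fun s t => F s t + G s t) := fun t ht =>
  ⟨fun s hs => ((hF t ht).1 s hs).fun_add ((hG t ht).1 s hs), (hF t ht).2.1.fun_add (hG t ht).2.1,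
    ((hF t ht).2.2.fun_add (hG t ht).2.2).congr fun s hs =>
      deriv_fun_add ((hF t ht).1 s hs) ((hG t ht).1 s hs)⟩

theorem const_mul (c : ℂ) (hG : IsRegularOn U G) : IsRegularOn U (fun s t => c * G s t) :=
  fun t ht => ⟨fun s hs => ((hG t ht).1 s hs).const_mul c, (hG t ht).2.1.const_mul c,
    ((hG t ht).2.2.const_mul c).congr fun s hs => deriv_const_mul c ((hG t ht).1 s hs)⟩

theorem sum {G : ℕ → ℂ → ℝ → ℂ} (hG : ∀ n, IsRegularOn U (G n)) (N : ℕ) :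
    IsRegularOn U (fun s t => ∑ n ∈ Finset.range N, G n s t) := by
  induction N with
  | zero => intro t _; simp
  | succ N ih => simpa only [Finset.sum_range_succ] using ih.add (hG N)

theorem comp_add_const (hG : IsRegularOn U G) {k : ℝ} (hk : 0 < k) :
    IsRegularOn U (fun s t => G s (t + k)) := fun t ht =>
  ⟨fun s hs => differentiableAt_comp_add_const.2 ((hG (t + k) (by positivity)).1 s hs),
    (hG (t + k) (by positivity)).2.1,
    (hG (t + k) (by positivity)).2.2.congr fun s _ => deriv_comp_add_const (G s) k t⟩

theorem iterate_Dh (hG : IsRegularOn U G) {k : ℝ} (hk : 0 < k) (n : ℕ) :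
    IsRegularOn U (fun s t => (Dh k)^[n] (G s) t) := by
  induction n with
  | zero => exact hG
  | succ n ih =>
    simp only [Function.iterate_succ_apply']
    have := (ih.comp_add_const hk).add (ih.const_mul (-1))
    simpa only [Dh, neg_one_mul, ← sub_eq_add_neg] using this

theorem congr (hG : IsRegularOn U G) (h : ∀ s ∈ U, ∀ t > 0, F s t = G s t) : IsRegularOn U F := by
  have hev : ∀ s ∈ U, ∀ t > 0, F s =ᶠ[nhds t] G s := fun s hs t ht => by
    filter_upwards [Ioi_mem_nhds ht] with x hx using h s hs x hx
  exact fun t ht => ⟨fun s hs => ((hG t ht).1 s hs).congr_of_eventuallyEq (hev s hs t ht),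
    (hG t ht).2.1.congr fun s hs => h s hs t ht,
    (hG t ht).2.2.congr fun s hs => (hev s hs t ht).deriv_eq⟩

theorem of_forall_halfPlane (h : ∀ N : ℕ, IsRegularOn {s | s.re < N} G) : IsRegularOn univ G := by
  have hnhds : ∀ s : ℂ, ∃ N : ℕ, {z : ℂ | z.re < N} ∈ nhds s := fun s => by
    obtain ⟨N, hN⟩ := exists_nat_gt s.re
    exact ⟨N, (isOpen_lt Complex.continuous_re continuous_const).mem_nhds hN⟩
  refine fun t ht => ⟨fun s _ => ?_, fun s _ => ?_, fun s _ => ?_⟩ <;>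
    obtain ⟨N, hN⟩ := hnhds s
  · exact (h N t ht).1 s (mem_of_mem_nhds hN)
  · exact ((h N t ht).2.1.differentiableAt hN).differentiableWithinAt
  · exact ((h N t ht).2.2.differentiableAt hN).differentiableWithinAt

end IsRegularOn

theorem IsSubexp.isRegularOn_LM {N : ℕ} {χ : ℝ → ℂ} (hχ : IsSubexp N χ) :
    IsRegularOn {s | s.re < N} (fun s t => LM χ (-s) t) := by
  have hneg : ∀ s ∈ {s : ℂ | s.re < N}, -(N : ℝ) < (-s).re := fun s hs => by
    simpa using hs
  refine fun t ht => ⟨fun s hs => (hχ.hasDerivAt_LM (hneg s hs) ht).differentiableAt,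
    fun s hs => ?_, ?_⟩
  · exact ((hχ.differentiableAt_LM (hneg s hs) ht).comp s
      differentiable_neg.differentiableAt).differentiableWithinAt
  · refine DifferentiableOn.congr (f := fun s => -LM (fun u => χ u * (u : ℂ)) (-s) t)
      (fun s hs => ?_) fun s hs => (hχ.hasDerivAt_LM (hneg s hs) ht).deriv
    have hs' : -((N + 1 : ℕ) : ℝ) < (-s).re := by
      have := hneg s hs
      push_cast; linarith
    exact ((hχ.mul_id.differentiableAt_LM hs' ht).comp s
      differentiable_neg.differentiableAt).neg.differentiableWithinAt

/-- The multiplier by which the difference operator `Δ_k` acts on the Laplace side. -/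
noncomputable def diffSymbol (k u : ℝ) : ℂ := (Real.exp (-(k * u)) - 1 : ℝ)

theorem measurable_diffSymbol (k : ℝ) : Measurable (diffSymbol k) := by
  unfold diffSymbol; fun_prop

theorem norm_diffSymbol {k u : ℝ} (hk : 0 < k) (hu : 0 < u) :
    ‖diffSymbol k u‖ = 1 - Real.exp (-(k * u)) := by
  rw [diffSymbol, Complex.norm_real, Real.norm_eq_abs, abs_of_nonpos, neg_sub]
  have : Real.exp (-(k * u)) ≤ 1 := Real.exp_le_one_iff.2 (by simp; positivity)
  linarith

theorem norm_diffSymbol_le {k u : ℝ} (hk : 0 < k) (hu : 0 < u) : ‖diffSymbol k u‖ ≤ k * u := by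
  rw [norm_diffSymbol hk hu]
  linarith [Real.add_one_le_exp (-(k * u))]

theorem norm_diffSymbol_lt_one {k u : ℝ} (hk : 0 < k) (hu : 0 < u) : ‖diffSymbol k u‖ < 1 := by
  rw [norm_diffSymbol hk hu]
  linarith [Real.exp_pos (-(k * u))]

theorem lmKernel_add_sub (χ : ℝ → ℂ) (s : ℂ) (t k u : ℝ) :
    lmKernel χ s (t + k) u - lmKernel χ s t u = lmKernel (fun u => χ u * diffSymbol k u) s t u := by
  have : Complex.exp (-((t + k) * u : ℝ)) =
      Complex.exp (-(t * u : ℝ)) * Complex.exp (-(k * u : ℝ)) := by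
    rw [← Complex.exp_add]; push_cast; ring_nf
  rw [lmKernel_mul]
  simp only [lmKernel, diffSymbol, this]
  push_cast
  ring

namespace IsSubexp

variable {N : ℕ} {χ φ : ℝ → ℂ} {k : ℝ}

theorem Dh_LM (hχ : IsSubexp N χ) (hk : 0 < k) {s : ℂ} (hs : -(N : ℝ) < s.re) {t : ℝ}
    (ht : 0 < t) : Dh k (LM χ s) t = LM (fun u => χ u * diffSymbol k u) s t := by
  rw [Dh, LM_eq_lmKernel, LM_eq_lmKernel, LM_eq_lmKernel, ← mul_sub,
    ← integral_sub (hχ.integrableOn_lmKernel hs (by positivity)) (hχ.integrableOn_lmKernel hs ht)]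
  simp only [lmKernel_add_sub]

theorem mul_diffSymbol_pow (hφ : IsSubexp 0 φ) (hk : 0 < k) (n : ℕ) :
    IsSubexp n (fun u => φ u * diffSymbol k u ^ n) := by
  have := hφ.mul_weight (v := fun u => diffSymbol k u ^ n) (A := k ^ n) (N := n)
    ((measurable_diffSymbol k).pow_const n) fun u hu => by
      rw [norm_pow]
      calc _ ≤ (k * u) ^ n := by gcongr; exact norm_diffSymbol_le hk hu
        _ = k ^ n * (1 * u ^ n) := by ring
        _ ≤ _ := by gcongr; linarith
  simpa using this

end IsSubexp

theorem MemDL.isSubexp_of_monotoneOn {ψ : ℝ → ℝ} (hψ : MemDL fun u => (ψ u : ℂ))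
    (hmono : MonotoneOn ψ (Ioi 0)) (h0 : ∀ u > 0, 0 ≤ ψ u) : IsSubexp 0 fun u => (ψ u : ℂ) := by
  refine ⟨hψ.1, fun x hx => ⟨Real.exp x * ∫ v in Ioi 0, Real.exp (-(x * v)) * ‖(ψ v : ℂ)‖, ?_⟩⟩
  intro u hu
  have hint := hψ.2.2 x hx
  have hsub : Ioc u (u + 1) ⊆ Ioi 0 := fun v hv => hu.trans hv.1
  have h1 : ∫ v in Ioc u (u + 1), Real.exp (-(x * (u + 1))) * ψ u ≤
      ∫ v in Ioc u (u + 1), Real.exp (-(x * v)) * ‖(ψ v : ℂ)‖ := by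
    refine setIntegral_mono_on (integrableOn_const (by simp)) (hint.mono_set hsub)
      measurableSet_Ioc fun v hv => ?_
    rw [Complex.norm_real, Real.norm_of_nonneg (h0 v (hsub hv))]
    have := hmono hu (hsub hv) hv.1.le
    have := h0 u hu
    have := hv.2
    gcongr
  have h2 : ∫ v in Ioc u (u + 1), Real.exp (-(x * v)) * ‖(ψ v : ℂ)‖ ≤
      ∫ v in Ioi 0, Real.exp (-(x * v)) * ‖(ψ v : ℂ)‖ :=
    setIntegral_mono_set hint (Eventually.of_forall fun v => by positivity) hsub.eventuallyLE
  have h3 := h1.trans h2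
  simp only [setIntegral_const, smul_eq_mul, Measure.real, Real.volume_Ioc, add_sub_cancel_left,
    ENNReal.ofReal_one, ENNReal.toReal_one, one_mul] at h3
  rw [Complex.norm_real, Real.norm_of_nonneg (h0 u hu), pow_zero, one_mul]
  calc ψ u = Real.exp (x * (u + 1)) * (Real.exp (-(x * (u + 1))) * ψ u) := by
        rw [← mul_assoc, ← Real.exp_add]; simp
    _ ≤ Real.exp (x * (u + 1)) * ∫ v in Ioi 0, Real.exp (-(x * v)) * ‖(ψ v : ℂ)‖ := by gcongr
    _ = _ := by rw [mul_add, Real.exp_add]; ring_nf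

theorem MemDLi.isSubexp {φ : ℝ → ℂ} (hφ : MemDLi φ) : IsSubexp 0 φ := by
  obtain ⟨hφ, ψ, hψ, hmono, hle⟩ := hφ
  have hψ' := hψ.isSubexp_of_monotoneOn hmono fun u hu => (norm_nonneg _).trans (hle u hu)
  refine ⟨hφ.1, fun x hx => (hψ'.2 x hx).imp fun C hC u hu => (hle u hu).trans ?_⟩
  refine le_trans ?_ (hC u hu)
  rw [Complex.norm_real]
  exact le_abs_self _

theorem IsSubexp.memDL {χ : ℝ → ℂ} (hχ : IsSubexp 0 χ) : MemDL χ := by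
  refine ⟨hχ.1, fun R _ => ?_, fun x hx => ?_⟩
  · obtain ⟨C, hC⟩ := hχ.2 1 one_pos
    refine Measure.integrableOn_of_bounded (M := |C| * Real.exp R) (by simp)
      hχ.1.aestronglyMeasurable ?_
    filter_upwards [ae_restrict_mem measurableSet_Ioo] with u hu
    refine (hC u hu.1).trans ?_
    rw [pow_zero, one_mul, one_mul]
    have := hu.2.le
    gcongr
    exact le_abs_self C
  · have hint : IntegrableOn (fun u => ‖lmKernel χ 1 x u‖) (Ioi 0) :=
      (hχ.integrableOn_lmKernel (s := 1) (by simp) hx).norm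
    refine hint.congr_fun (fun u hu => ?_) measurableSet_Ioi
    simp [norm_lmKernel _ _ _ hu]

theorem MemDLi.mul_weight {φ v : ℝ → ℂ} (hφ : MemDLi φ) (hv : Measurable v) {A : ℝ}
    (hA : ∀ u > 0, ‖v u‖ ≤ A * (1 + u)) : MemDLi fun u => φ u * v u := by
  have hv' : ∀ u > 0, ‖v u‖ ≤ A * ((1 + u) * u ^ 0) := by simpa using hA
  refine ⟨(hφ.isSubexp.mul_weight hv hv').memDL, ?_⟩
  obtain ⟨-, ψ, hψ, hmono, hle⟩ := hφ
  have h0 : ∀ u > 0, 0 ≤ ψ u := fun u hu => (norm_nonneg _).trans (hle u hu)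
  have hA0 : 0 ≤ A := by
    have := (norm_nonneg _).trans (hA 1 one_pos)
    linarith
  have hψ' := hψ.isSubexp_of_monotoneOn hmono h0
  refine ⟨fun u => ψ u * (A * (1 + u)), ?_, fun a ha b hb hab => ?_, fun u hu => ?_⟩
  · have := (hψ'.mul_weight (N := 0) (A := A) (v := fun u => ((A * (1 + u) : ℝ) : ℂ))
      (by fun_prop) fun u hu => by
        rw [Complex.norm_real, Real.norm_of_nonneg (by positivity)]; simp).memDL
    simpa using this
  · have ha' : (0:ℝ) < a := ha
    have := hmono ha hb hab
    have := h0 b hb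
    simp only
    gcongr
  · rw [norm_mul]
    exact mul_le_mul (hle u hu) (hA u hu) (norm_nonneg _) (h0 u hu)

namespace MemHwith

variable {f : ℂ → ℝ → ℂ} {φ : ℝ → ℂ} {k : ℝ}

theorem isRegularOn (hf : MemHwith f φ) : IsRegularOn univ f := fun t ht =>
  ⟨fun s _ => hf.1 s t ht, (hf.2.1 t ht).differentiableOn, (hf.2.2.1 t ht).differentiableOn⟩

theorem iterate_Dh_eq_of_one_lt_re (hf : MemHwith f φ) (hk : 0 < k) (n : ℕ) {s : ℂ}
    (hs : 1 < s.re) {t : ℝ} (ht : 0 < t) :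
    (Dh k)^[n] (f (-s)) t = LM (fun u => φ u * diffSymbol k u ^ n) s t := by
  induction n generalizing t with
  | zero => simpa using hf.2.2.2.2.2 s hs t ht
  | succ n ih =>
    have hs' : -(n : ℝ) < s.re := by linarith [n.cast_nonneg (α := ℝ)]
    rw [Function.iterate_succ_apply', Dh, ih ht, ih (add_pos ht hk)]
    have := (hf.2.2.2.1.isSubexp.mul_diffSymbol_pow hk n).Dh_LM hk hs' ht
    rw [Dh] at this
    simpa only [mul_assoc, ← pow_succ] using this

theorem iterate_Dh_eq (hf : MemHwith f φ) (hk : 0 < k) (n : ℕ) {s : ℂ}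
    (hs : s.re < n) {t : ℝ} (ht : 0 < t) :
    (Dh k)^[n] (f s) t = LM (fun u => φ u * diffSymbol k u ^ n) (-s) t := by
  have hopen : IsOpen {s : ℂ | s.re < n} := isOpen_lt Complex.continuous_re continuous_const
  have hF := ((hf.isRegularOn.iterate_Dh hk n) t ht).2.1.mono (subset_univ {s : ℂ | s.re < n})
  have hG := ((hf.2.2.2.1.isSubexp.mul_diffSymbol_pow hk n).isRegularOn_LM t ht).2.1
  have hmem : (-2 : ℂ) ∈ {s : ℂ | s.re < n} := by
    simp only [mem_ofPred_eq, Complex.neg_re, Complex.re_ofNat]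
    linarith [n.cast_nonneg (α := ℝ)]
  refine (hF.analyticOnNhd hopen).eqOn_of_preconnected_of_eventuallyEq (hG.analyticOnNhd hopen)
    (convex_halfSpace_re_lt _).isPreconnected hmem ?_ hs
  have h1 : {s : ℂ | s.re < -1} ∈ nhds (-2 : ℂ) :=
    (isOpen_lt Complex.continuous_re continuous_const).mem_nhds (by simp)
  filter_upwards [h1] with z hz
  have hz' : 1 < (-z).re := by
    have : z.re < -1 := hz
    rw [Complex.neg_re]; linarith
  simpa using hf.iterate_Dh_eq_of_one_lt_re hk n hz' ht

end MemHwith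

/-- The tails of `∑ c n (1 - e^{-ku})^n` converge absolutely with at most linear growth in `u`. -/
def HasLinearTails (k C : ℝ) (c : ℕ → ℂ) : Prop :=
  ∀ (N : ℕ), ∀ u > 0, (Summable fun n => ‖c (n + N)‖ * ‖diffSymbol k u‖ ^ n) ∧
    ∑' n, ‖c (n + N)‖ * ‖diffSymbol k u‖ ^ n ≤ C * (1 + u)

/-- The tail, from the index `N` on, of the multiplier `∑ c n (e^{-ku} - 1)^n`. -/
noncomputable def tailSymbol (k : ℝ) (c : ℕ → ℂ) (N : ℕ) (u : ℝ) : ℂ :=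
  ∑' n, c (n + N) * diffSymbol k u ^ (n + N)

theorem measurable_tailSymbol (k : ℝ) (c : ℕ → ℂ) (N : ℕ) : Measurable (tailSymbol k c N) :=
  Measurable.tsum fun n => ((measurable_diffSymbol k).pow_const (n + N)).const_mul _

namespace HasLinearTails

variable {k C : ℝ} {c : ℕ → ℂ}

theorem norm_term (k : ℝ) (c : ℕ → ℂ) (N n : ℕ) (u : ℝ) :
    ‖c (n + N) * diffSymbol k u ^ (n + N)‖ =
      ‖c (n + N)‖ * ‖diffSymbol k u‖ ^ n * ‖diffSymbol k u‖ ^ N := by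
  rw [norm_mul, norm_pow, pow_add, mul_assoc]

theorem summable_norm (hc : HasLinearTails k C c) (N : ℕ) {u : ℝ} (hu : 0 < u) :
    Summable fun n => ‖c (n + N) * diffSymbol k u ^ (n + N)‖ := by
  simp only [norm_term]
  exact (hc N u hu).1.mul_right _

theorem tsum_norm_le (hc : HasLinearTails k C c) (hk : 0 < k) (N : ℕ) {u : ℝ} (hu : 0 < u) :
    ∑' n, ‖c (n + N) * diffSymbol k u ^ (n + N)‖ ≤ C * k ^ N * ((1 + u) * u ^ N) := by
  simp only [norm_term]
  rw [tsum_mul_right]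
  have h0 : 0 ≤ C * (1 + u) := le_trans (tsum_nonneg fun n => by positivity) (hc N u hu).2
  calc _ ≤ C * (1 + u) * (k * u) ^ N := by
        gcongr
        · exact (hc N u hu).2
        · exact norm_diffSymbol_le hk hu
    _ = _ := by ring

theorem norm_tailSymbol_le (hc : HasLinearTails k C c) (hk : 0 < k) (N : ℕ) {u : ℝ} (hu : 0 < u) :
    ‖tailSymbol k c N u‖ ≤ C * k ^ N * ((1 + u) * u ^ N) :=
  (norm_tsum_le_tsum_norm (hc.summable_norm N hu)).trans (hc.tsum_norm_le hk N hu)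

end HasLinearTails

section NewtonSeries

variable {f : ℂ → ℝ → ℂ} {φ : ℝ → ℂ} {k C : ℝ} {c : ℕ → ℂ} {N : ℕ} {s : ℂ} {t : ℝ}

theorem IsSubexp.mul_tailSymbol (hφ : IsSubexp 0 φ) (hk : 0 < k) (hc : HasLinearTails k C c)
    (N : ℕ) : IsSubexp N fun u => φ u * tailSymbol k c N u := by
  simpa using hφ.mul_weight (measurable_tailSymbol k c N)
    fun u hu => hc.norm_tailSymbol_le hk N hu

theorem IsSubexp.integrableOn_tsum_norm (hφ : IsSubexp 0 φ) (hk : 0 < k)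
    (hc : HasLinearTails k C c) (hs : -(N : ℝ) < s.re) (ht : 0 < t) :
    IntegrableOn (fun u => ∑' n, ‖c (n + N) * diffSymbol k u ^ (n + N) * lmKernel φ s t u‖)
      (Ioi 0) := by
  set v : ℝ → ℂ := fun u => ((∑' n, ‖c (n + N) * diffSymbol k u ^ (n + N)‖ : ℝ) : ℂ) with hv
  have hvm : Measurable v := Complex.measurable_ofReal.comp <| Measurable.tsum fun n =>
    (((measurable_diffSymbol k).pow_const (n + N)).const_mul _).norm
  have hvn : ∀ u, ‖v u‖ = ∑' n, ‖c (n + N) * diffSymbol k u ^ (n + N)‖ := fun u => by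
    rw [hv, Complex.norm_real, Real.norm_of_nonneg (tsum_nonneg fun n => norm_nonneg _)]
  have hsub : IsSubexp N fun u => φ u * v u := by
    simpa using hφ.mul_weight hvm (A := C * k ^ N) (N := N) fun u hu => by
      rw [hvn]; exact hc.tsum_norm_le hk N hu
  have hint := (hsub.integrableOn_lmKernel hs ht).norm
  refine hint.congr (Eventually.of_forall fun u => ?_)
  simp only [lmKernel_mul]
  rw [norm_mul, hvn, ← tsum_mul_right]
  simp only [norm_mul]

theorem IsSubexp.summable_integral_norm (hφ : IsSubexp 0 φ) (hk : 0 < k)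
    (hc : HasLinearTails k C c) (hs : -(N : ℝ) < s.re) (ht : 0 < t) :
    Summable fun n => ∫ u in Ioi (0:ℝ),
      ‖c (n + N) * diffSymbol k u ^ (n + N) * lmKernel φ s t u‖ := by
  have hm : ∀ n, Measurable fun u => c (n + N) * diffSymbol k u ^ (n + N) * lmKernel φ s t u :=
    fun n => (((measurable_diffSymbol k).pow_const _).const_mul _).mul (hφ.1.lmKernel s t)
  have hsum : ∀ u > 0, Summable fun n =>
      ‖c (n + N) * diffSymbol k u ^ (n + N) * lmKernel φ s t u‖ := fun u hu => by
    simp only [norm_mul _ (lmKernel φ s t u)]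
    exact (hc.summable_norm N hu).mul_right _
  refine (hasSum_integral_of_dominated_convergence _
    (fun n => (hm n).norm.aestronglyMeasurable)
    (fun n => Eventually.of_forall fun u => (norm_norm _).le) ?_
    (hφ.integrableOn_tsum_norm hk hc hs ht)
    (f := fun u => ∑' n, ‖c (n + N) * diffSymbol k u ^ (n + N) * lmKernel φ s t u‖) ?_).summable
  · filter_upwards [ae_restrict_mem measurableSet_Ioi] with u hu using hsum u hu
  · filter_upwards [ae_restrict_mem measurableSet_Ioi] with u hu using (hsum u hu).hasSum

theorem IsSubexp.hasSum_LM (hφ : IsSubexp 0 φ) (hk : 0 < k)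
    (hc : HasLinearTails k C c) (hs : -(N : ℝ) < s.re) (ht : 0 < t) :
    HasSum (fun n => c (n + N) * LM (fun u => φ u * diffSymbol k u ^ (n + N)) s t)
      (LM (fun u => φ u * tailSymbol k c N u) s t) := by
  have hm : ∀ n, Measurable fun u => c (n + N) * diffSymbol k u ^ (n + N) * lmKernel φ s t u :=
    fun n => (((measurable_diffSymbol k).pow_const _).const_mul _).mul (hφ.1.lmKernel s t)
  have key := hasSum_integral_of_dominated_convergence _
    (fun n => (hm n).aestronglyMeasurable)
    (fun n => Eventually.of_forall fun u => le_rfl) ?_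
    (hφ.integrableOn_tsum_norm hk hc hs ht)
    (f := fun u => tailSymbol k c N u * lmKernel φ s t u) ?_
  · have := key.mul_left ((Complex.Gamma s)⁻¹)
    simp only [LM_eq_lmKernel, lmKernel_mul]
    refine this.congr_fun fun n => ?_
    rw [mul_left_comm, ← integral_const_mul]
    simp only [mul_assoc]
  · filter_upwards [ae_restrict_mem measurableSet_Ioi] with u hu
    simp only [norm_mul _ (lmKernel φ s t u)]
    exact (hc.summable_norm N hu).mul_right _
  · filter_upwards [ae_restrict_mem measurableSet_Ioi] with u hu
    exact (hc.summable_norm N hu).of_norm.hasSum.mul_right _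

theorem MemHwith.norm_term_le (hf : MemHwith f φ) (hk : 0 < k) (n : ℕ) (hs : s.re < n)
    {τ : ℝ} (hτ : 0 < τ) (ht : τ ≤ t) :
    ‖c n * (Dh k)^[n] (f s) t‖ ≤ ‖(Complex.Gamma (-s))⁻¹‖ *
      ∫ u in Ioi (0:ℝ), ‖c n * diffSymbol k u ^ n * lmKernel φ (-s) τ u‖ := by
  have hsub := hf.2.2.2.1.isSubexp.mul_diffSymbol_pow hk n
  have hs' : -(n : ℝ) < (-s).re := by simpa using hs
  rw [hf.iterate_Dh_eq hk n hs (hτ.trans_le ht), LM_eq_lmKernel, mul_left_comm, norm_mul]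
  gcongr
  rw [← integral_const_mul]
  refine norm_integral_le_of_norm_le ?_ ?_
  · have := ((hsub.integrableOn_lmKernel hs' hτ).const_mul (c n)).norm
    simpa only [lmKernel_mul, mul_assoc] using this
  · filter_upwards [ae_restrict_mem measurableSet_Ioi] with u hu
    rw [lmKernel_mul, ← mul_assoc, norm_mul, norm_mul _ (lmKernel φ (-s) τ u)]
    gcongr
    exact norm_lmKernel_anti _ _ ht hu

theorem MemHwith.exists_summable_bound (hf : MemHwith f φ) (hk : 0 < k)
    (hc : HasLinearTails k C c) (s : ℂ) {τ : ℝ} (hτ : 0 < τ) :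
    ∃ M : ℕ → ℝ, Summable M ∧ ∀ᶠ n in atTop, ∀ t ≥ τ, ‖c n * (Dh k)^[n] (f s) t‖ ≤ M n := by
  obtain ⟨N, hN⟩ := exists_nat_gt s.re
  refine ⟨fun n => ‖(Complex.Gamma (-s))⁻¹‖ *
      ∫ u in Ioi (0:ℝ), ‖c n * diffSymbol k u ^ n * lmKernel φ (-s) τ u‖, ?_, ?_⟩
  · have := hf.2.2.2.1.isSubexp.summable_integral_norm (N := N) (s := -s) hk hc
      (by simpa using hN) hτ
    exact ((summable_nat_add_iff (f := fun n => ∫ u in Ioi (0:ℝ),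
      ‖c n * diffSymbol k u ^ n * lmKernel φ (-s) τ u‖) N).1 this).mul_left _
  · filter_upwards [eventually_ge_atTop N] with n hn t ht
    exact hf.norm_term_le hk n (hN.trans_le (by exact_mod_cast hn)) hτ ht

theorem MemHwith.aluOn (hf : MemHwith f φ) (hk : 0 < k) (hc : HasLinearTails k C c) (s : ℂ) :
    ALUOn (fun n t => c n * (Dh k)^[n] (f s) t) (Ioi 0) := by
  refine ⟨fun t ht => ?_, fun V hV t ht => ?_⟩
  · obtain ⟨M, hM, hle⟩ := hf.exists_summable_bound hk hc s ht
    refine hM.of_norm_bounded_eventually_nat ?_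
    filter_upwards [hle] with n hn
    rw [norm_norm]
    exact hn t le_rfl
  · obtain ⟨M, hM, hle⟩ := hf.exists_summable_bound hk hc s (half_pos ht)
    have ht' : 0 < t := ht
    exact ⟨Ici (t / 2), mem_nhdsWithin_of_mem_nhds (Ici_mem_nhds (by linarith)),
      tendstoUniformlyOn_tsum_nat_eventually hM hle V hV⟩

theorem MemHwith.tsum_eq (hf : MemHwith f φ) (hk : 0 < k) (hc : HasLinearTails k C c)
    (hs : s.re < N) (ht : 0 < t) :
    ∑' n, c n * (Dh k)^[n] (f s) t = ∑ n ∈ Finset.range N, c n * (Dh k)^[n] (f s) t +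
      LM (fun u => φ u * tailSymbol k c N u) (-s) t := by
  have hsum := ((hf.aluOn hk hc s).1 t ht).of_norm
  rw [← hsum.sum_add_tsum_nat_add N,
    ← (hf.2.2.2.1.isSubexp.hasSum_LM hk hc (s := -s) (N := N) (by simpa using hs) ht).tsum_eq]
  congr 1
  refine tsum_congr fun n => ?_
  simp only
  rw [hf.iterate_Dh_eq hk (n + N) (hs.trans_le (by push_cast; simp)) ht]

theorem MemHwith.tsum_iterate_Dh (hf : MemHwith f φ) (hk : 0 < k) (hc : HasLinearTails k C c) :
    MemHwith (fun s t => ∑' n, c n * (Dh k)^[n] (f s) t)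
      (fun u => φ u * tailSymbol k c 0 u) := by
  have hreg : IsRegularOn univ (fun s t => ∑' n, c n * (Dh k)^[n] (f s) t) := by
    refine IsRegularOn.of_forall_halfPlane fun N => ?_
    refine IsRegularOn.congr ?_ fun s hs t ht => hf.tsum_eq hk hc hs ht
    exact ((IsRegularOn.sum (fun n => (hf.isRegularOn.iterate_Dh hk n).const_mul (c n)) N).mono
      (subset_univ _)).add (hf.2.2.2.1.isSubexp.mul_tailSymbol hk hc N).isRegularOn_LM
  refine ⟨fun s t ht => (hreg t ht).1 s (mem_univ s),
    fun t ht => differentiableOn_univ.1 (hreg t ht).2.1,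
    fun t ht => differentiableOn_univ.1 (hreg t ht).2.2,
    hf.2.2.2.1.mul_weight (measurable_tailSymbol k c 0) (A := C) fun u hu => ?_,
    fun t ht => ?_, fun s hs t ht => ?_⟩
  · simpa using hc.norm_tailSymbol_le hk 0 hu
  · have := hf.tsum_eq hk hc (s := -1) (N := 0) (by simp) ht
    simpa [Lap_eq_LM] using this
  · have := hf.tsum_eq hk hc (s := -s) (N := 0) (by simp; linarith) ht
    simpa using this

end NewtonSeries

theorem hasLinearTails_bernoulli {h : ℝ} (hh : 0 < h) :
    HasLinearTails h (1 + h) fun n => (-1 : ℂ) ^ n / (n + 1) := by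
  intro N u hu
  set q := ‖diffSymbol h u‖ with hq
  have hq0 : 0 ≤ q := norm_nonneg _
  have hq1 : q < 1 := norm_diffSymbol_lt_one hh hu
  have hlog : HasSum (fun n : ℕ => q ^ (n + 1) / (n + 1)) (h * u) := by
    have := Real.hasSum_pow_div_log_of_abs_lt_one (x := q) (by rwa [abs_of_nonneg hq0])
    rwa [hq, norm_diffSymbol hh hu, sub_sub_cancel, Real.log_exp, neg_neg, ← norm_diffSymbol hh hu,
      ← hq] at this
  have hle : ∀ n : ℕ, q ^ (n + 1) / ((n + 1 : ℕ) + 1 : ℝ) ≤ q ^ (n + 1) / (n + 1) := fun n => by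
    gcongr; simp
  have hs1 : Summable fun n : ℕ => q ^ (n + 1) / ((n + 1 : ℕ) + 1 : ℝ) :=
    hlog.summable.of_nonneg_of_le (fun n => by positivity) hle
  have hs : Summable fun n : ℕ => q ^ n / ((n : ℝ) + 1) :=
    (summable_nat_add_iff (f := fun n : ℕ => q ^ n / ((n : ℝ) + 1)) 1).1 hs1
  have hcoeff : ∀ n : ℕ, ‖(-1 : ℂ) ^ (n + N) / ((n + N : ℕ) + 1)‖ * q ^ n ≤
      q ^ n / ((n : ℝ) + 1) := fun n => by
    have : ‖(((n + N : ℕ) : ℂ) + 1)‖ = ((n + N : ℕ) : ℝ) + 1 := by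
      exact_mod_cast Complex.norm_natCast (n + N + 1)
    rw [norm_div, norm_pow, norm_neg, norm_one, one_pow, this, one_div_mul_eq_div]
    gcongr
    simp
  have hs2 := hs.of_nonneg_of_le (fun n => by positivity) hcoeff
  refine ⟨hs2, (hs2.tsum_le_tsum hcoeff hs).trans ?_⟩
  rw [hs.tsum_eq_zero_add]
  have := hs1.tsum_le_tsum hle hlog.summable
  rw [hlog.tsum_eq] at this
  simp only [pow_zero, Nat.cast_zero, zero_add, div_one]
  nlinarith

theorem gbinom_succ (h : ℝ) (n : ℕ) : gbinom h (n + 1) = gbinom h n * ((h - n) / (n + 1)) := by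
  rw [gbinom, gbinom, Finset.prod_range_succ, Nat.factorial_succ]
  push_cast
  field_simp

theorem summable_abs_gbinom {h : ℝ} (hh : 0 < h) : Summable fun n => |gbinom h n| := by
  obtain ⟨m, hm⟩ := exists_nat_gt h
  have hterm : ∀ n : ℕ, |gbinom h (n + m)| =
      (|gbinom h (n + m)| * ((n + m : ℕ) : ℝ) -
        |gbinom h (n + 1 + m)| * ((n + 1 + m : ℕ) : ℝ)) / h := fun n => by
    have hn : h ≤ ((n + m : ℕ) : ℝ) := by push_cast; linarith [n.cast_nonneg (α := ℝ)]
    rw [add_right_comm n 1 m, gbinom_succ, abs_mul, abs_div,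
      abs_of_nonpos (sub_nonpos.2 hn), abs_of_pos (by positivity : (0:ℝ) < ((n + m : ℕ) : ℝ) + 1)]
    push_cast
    field_simp
    ring
  refine (summable_nat_add_iff m).1 ?_
  refine summable_of_sum_range_le (c := |gbinom h (0 + m)| * ((0 + m : ℕ) : ℝ) / h)
    (fun n => abs_nonneg _) fun n => ?_
  rw [Finset.sum_congr rfl fun i _ => hterm i, ← Finset.sum_div,
    Finset.sum_range_sub' fun i => |gbinom h (i + m)| * ((i + m : ℕ) : ℝ)]
  gcongr
  have : 0 ≤ |gbinom h (n + m)| * ((n + m : ℕ) : ℝ) := by positivity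
  linarith

theorem hasLinearTails_newton {h : ℝ} (hh : 0 < h) :
    HasLinearTails 1 (∑' n, |gbinom h n|) fun n => (gbinom h n : ℂ) := by
  intro N u hu
  have hs := summable_abs_gbinom hh
  have hsN := (summable_nat_add_iff N).2 hs
  have hle : ∀ n, ‖(gbinom h (n + N) : ℂ)‖ * ‖diffSymbol 1 u‖ ^ n ≤ |gbinom h (n + N)| := fun n => by
    rw [Complex.norm_real, Real.norm_eq_abs]
    exact mul_le_of_le_one_right (abs_nonneg _)
      (pow_le_one₀ (norm_nonneg _) (norm_diffSymbol_lt_one one_pos hu).le)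
  have hs2 := hsN.of_nonneg_of_le (fun n => by positivity) hle
  refine ⟨hs2, (hs2.tsum_le_tsum hle hsN).trans ?_⟩
  have h1 : ∑' n, |gbinom h (n + N)| ≤ ∑' n, |gbinom h n| := by
    rw [← hs.sum_add_tsum_nat_add N]
    exact le_add_of_nonneg_left (Finset.sum_nonneg fun i _ => abs_nonneg _)
  refine h1.trans (le_mul_of_one_le_right (tsum_nonneg fun n => abs_nonneg _) (by linarith))

/-- for `f ∈ ℋ` and `h > 0`, for every `s ∈ ℂ` the Bernoulli series
`(B_h f_s)` and the Newton series `(E^h f_s)` converge absolutely and locally uniformly on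
`(0,∞)`, and `(s,t) ↦ (B_h f_s)(t)` and `(s,t) ↦ (E^h f_s)(t)` again belong to `ℋ`. -/
theorem stmt8 (f : ℂ → ℝ → ℂ) (hf : MemH f) (h : ℝ) (hh : 0 < h) :
    (∀ s : ℂ, ALUOn (BTerm h (f s)) (Ioi 0)) ∧
    (∀ s : ℂ, ALUOn (NTerm h (f s)) (Ioi 0)) ∧
    MemH (fun s t => Bop h (f s) t) ∧
    MemH (fun s t => Nop h (f s) t) := by
  obtain ⟨φ, hf⟩ := hf
  have hB := hasLinearTails_bernoulli hh
  have hN := hasLinearTails_newton hh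
  exact ⟨fun s => hf.aluOn hh hB s, fun s => hf.aluOn one_pos hN s,
    ⟨_, hf.tsum_iterate_Dh hh hB⟩, ⟨_, hf.tsum_iterate_Dh one_pos hN⟩⟩
end

section
/- Let f ∈ ℋ and let m ≥ 1 be an integer. Define g : ℂ × (0,∞) → ℂ by g(s,u) = m^{−s} f(s, m u) (principal power m^{−s}). Then g ∈ ℋ, and for every s ∈ ℂ and t > 0 all the Bernoulli series below converge absolutely and locally uniformly and (B f_s)(t) = (m^s/m) Σ_{i=0}^{m−1} (B g_s)((t+i)/m). -/
open MeasureTheory Filter Set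

theorem MemDLi.exists_norm_le_exp {φ : ℝ → ℂ} (h : MemDLi φ) {ε : ℝ} (hε : 0 < ε) :
    ∃ C : ℝ, 0 ≤ C ∧ ∀ u ∈ Ioi (0:ℝ), ‖φ u‖ ≤ C * Real.exp (ε * u) := by
  obtain ⟨-, ψ, ⟨-, -, hψ⟩, hmono, hle⟩ := h
  have hint := hψ ε hε
  refine ⟨ε * ∫ v in Ioi (0:ℝ), Real.exp (-(ε * v)) * ‖(ψ v : ℂ)‖, ?_, fun u hu => ?_⟩
  · exact mul_nonneg hε.le (integral_nonneg fun v => by positivity)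
  have hu0 : (0:ℝ) < u := hu
  have hexp : IntegrableOn (fun v => Real.exp (-(ε * v))) (Ioi u) := by
    simpa using exp_neg_integrableOn_Ioi u hε
  have hval : ∫ v in Ioi u, Real.exp (-(ε * v)) = Real.exp (-(ε * u)) / ε := by
    have := integral_exp_mul_Ioi (neg_lt_zero.mpr hε) u
    simp only [neg_mul] at this
    rw [this, neg_div_neg_eq]
  have h1 : ∫ v in Ioi u, Real.exp (-(ε * v)) * ψ u ≤
      ∫ v in Ioi u, Real.exp (-(ε * v)) * ‖(ψ v : ℂ)‖ := by
    refine setIntegral_mono_on (hexp.mul_const _)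
      (hint.mono_set (Ioi_subset_Ioi hu0.le)) measurableSet_Ioi fun v hv => ?_
    have hv' : u < v := hv
    gcongr
    calc ψ u ≤ ψ v := hmono hu (hu0.trans hv') hv'.le
      _ ≤ ‖(ψ v : ℂ)‖ := by rw [Complex.norm_real]; exact le_abs_self _
  have h2 : ∫ v in Ioi u, Real.exp (-(ε * v)) * ‖(ψ v : ℂ)‖ ≤
      ∫ v in Ioi (0:ℝ), Real.exp (-(ε * v)) * ‖(ψ v : ℂ)‖ :=
    setIntegral_mono_set hint (ae_of_all _ fun v => by positivity)
      (Ioi_subset_Ioi hu0.le).eventuallyLE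
  rw [integral_mul_const, hval] at h1
  refine (hle u hu).trans ?_
  have h3 := mul_le_mul_of_nonneg_left (h1.trans h2) (mul_pos hε (Real.exp_pos (ε * u))).le
  have h4 : ε * Real.exp (ε * u) * (Real.exp (-(ε * u)) / ε * ψ u) = ψ u := by
    rw [Real.exp_neg]
    field_simp
  rw [h4] at h3
  linarith

theorem integrableOn_exp_neg_mul_rpow {a σ : ℝ} (ha : 0 < a) (hσ : 0 < σ) :
    IntegrableOn (fun u : ℝ => Real.exp (-(a * u)) * u ^ (σ - 1)) (Ioi 0) := by
  have := integrableOn_rpow_mul_exp_neg_mul_rpow (p := 1) (s := σ - 1) (b := a)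
    (by linarith) one_pos ha
  refine this.congr_fun (fun u _ => ?_) measurableSet_Ioi
  simp only [Real.rpow_one, neg_mul]
  ring

section MellinOfBound

variable {h : ℝ → ℂ} {a C : ℝ} {n : ℕ}

theorem integrableOn_of_norm_le_exp (hm : Measurable h) (ha : 0 < a)
    (hb : ∀ u ∈ Ioi (0:ℝ), ‖h u‖ ≤ C * (u ^ n * Real.exp (-(a * u)))) :
    IntegrableOn h (Ioi 0) := by
  have h1 := (integrableOn_exp_neg_mul_rpow ha (σ := n + 1) (by positivity)).const_mul C
  refine Integrable.mono' h1 hm.aestronglyMeasurable ?_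
  refine (ae_restrict_iff' measurableSet_Ioi).2 (ae_of_all _ fun u hu => (hb u hu).trans ?_)
  rw [add_sub_cancel_right, Real.rpow_natCast, mul_comm (u ^ n)]

theorem isBigO_atTop_of_norm_le_exp (ha : 0 < a)
    (hb : ∀ u ∈ Ioi (0:ℝ), ‖h u‖ ≤ C * (u ^ n * Real.exp (-(a * u)))) :
    h =O[atTop] fun u => Real.exp (-(a / 2) * u) := by
  have h1 : h =O[atTop] fun u : ℝ => u ^ (n : ℝ) * Real.exp (-(a * u)) := by
    refine Asymptotics.IsBigO.of_bound C ?_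
    filter_upwards [eventually_gt_atTop 0] with u hu
    have := hb u hu
    rwa [Real.rpow_natCast, Real.norm_of_nonneg (by positivity)]
  have h2 := (isLittleO_rpow_exp_pos_mul_atTop n (half_pos ha)).isBigO.mul
    (Asymptotics.isBigO_refl (fun u : ℝ => Real.exp (-(a * u))) atTop)
  refine (h1.trans h2).congr_right fun u => ?_
  rw [← Real.exp_add]
  ring_nf

theorem isBigO_zero_of_norm_le_exp (ha : 0 < a)
    (hb : ∀ u ∈ Ioi (0:ℝ), ‖h u‖ ≤ C * (u ^ n * Real.exp (-(a * u)))) :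
    h =O[nhdsWithin 0 (Ioi 0)] fun u => u ^ (-(-(n : ℝ))) := by
  refine Asymptotics.IsBigO.of_bound |C| ?_
  filter_upwards [self_mem_nhdsWithin] with u hu
  have hu0 : (0:ℝ) < u := hu
  rw [neg_neg, Real.rpow_natCast, Real.norm_of_nonneg (by positivity)]
  refine (hb u hu).trans ?_
  have h1 : Real.exp (-(a * u)) ≤ 1 := Real.exp_le_one_iff.2 (by nlinarith)
  calc C * (u ^ n * Real.exp (-(a * u))) ≤ |C| * (u ^ n * Real.exp (-(a * u))) := by
        gcongr; exact le_abs_self C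
    _ ≤ |C| * (u ^ n * 1) := by gcongr
    _ = |C| * u ^ n := by rw [mul_one]

theorem mellinConvergent_of_norm_le_exp (hm : Measurable h) (ha : 0 < a)
    (hb : ∀ u ∈ Ioi (0:ℝ), ‖h u‖ ≤ C * (u ^ n * Real.exp (-(a * u)))) {z : ℂ}
    (hz : -(n : ℝ) < z.re) : MellinConvergent h z :=
  mellinConvergent_of_isBigO_rpow_exp (half_pos ha)
    (integrableOn_of_norm_le_exp hm ha hb).locallyIntegrableOn
    (isBigO_atTop_of_norm_le_exp ha hb) (isBigO_zero_of_norm_le_exp ha hb) hz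

theorem differentiableAt_mellin_of_norm_le_exp (hm : Measurable h) (ha : 0 < a)
    (hb : ∀ u ∈ Ioi (0:ℝ), ‖h u‖ ≤ C * (u ^ n * Real.exp (-(a * u)))) {z : ℂ}
    (hz : -(n : ℝ) < z.re) : DifferentiableAt ℂ (mellin h) z :=
  mellin_differentiableAt_of_isBigO_rpow_exp (half_pos ha)
    (integrableOn_of_norm_le_exp hm ha hb).locallyIntegrableOn
    (isBigO_atTop_of_norm_le_exp ha hb) (isBigO_zero_of_norm_le_exp ha hb) hz

end MellinOfBound

theorem one_sub_exp_neg_mem {u : ℝ} (hu : 0 < u) :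
    0 < 1 - Real.exp (-u) ∧ 1 - Real.exp (-u) < 1 ∧ 1 - Real.exp (-u) ≤ u :=
  ⟨by simpa using hu, by simpa using Real.exp_pos (-u),
    by linarith [Real.add_one_le_exp (-u)]⟩

theorem hasSum_one_sub_exp_neg {u : ℝ} (hu : 0 < u) :
    HasSum (fun n : ℕ => (1 - Real.exp (-u)) ^ (n + 1) / ((n : ℝ) + 1)) u := by
  obtain ⟨h0, h1, -⟩ := one_sub_exp_neg_mem hu
  have := Real.hasSum_pow_div_log_of_abs_lt_one (x := 1 - Real.exp (-u))
    (by rw [abs_of_pos h0]; exact h1)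
  simpa using this

theorem sum_one_sub_exp_neg_le {u : ℝ} (hu : 0 < u) {N : ℕ} (hN : 1 ≤ N) (k : ℕ) :
    ∑ n ∈ Finset.range k, (1 - Real.exp (-u)) ^ (n + N) / (((n + N : ℕ) : ℝ) + 1) ≤ u ^ N := by
  obtain ⟨h0, h1, h2⟩ := one_sub_exp_neg_mem hu
  obtain ⟨N, rfl⟩ := Nat.exists_eq_add_of_le' hN
  calc ∑ n ∈ Finset.range k, (1 - Real.exp (-u)) ^ (n + (N + 1)) / (((n + (N + 1) : ℕ) : ℝ) + 1)
      ≤ ∑ n ∈ Finset.range k,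
          (1 - Real.exp (-u)) ^ N * ((1 - Real.exp (-u)) ^ (n + 1) / ((n : ℝ) + 1)) := by
        refine Finset.sum_le_sum fun n _ => ?_
        rw [← mul_div_assoc, ← pow_add, show N + (n + 1) = n + (N + 1) by ring]
        gcongr
        simp
    _ = (1 - Real.exp (-u)) ^ N *
          ∑ n ∈ Finset.range k, (1 - Real.exp (-u)) ^ (n + 1) / ((n : ℝ) + 1) := by
        rw [Finset.mul_sum]
    _ ≤ u ^ N * u := by
        gcongr
        exact sum_le_hasSum _ (fun n _ => by positivity) (hasSum_one_sub_exp_neg hu)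
    _ = u ^ (N + 1) := (pow_succ _ _).symm

/-- The nonnegative kernel majorising the integral representation of the `n`-th Bernoulli term. -/
noncomputable def bernoulliMajorant (a R : ℝ) (n : ℕ) (u : ℝ) : ℝ :=
  Real.exp (-(a * u)) * ((1 - Real.exp (-u)) ^ n / ((n : ℝ) + 1)) * (u ^ (-R - 1) + u ^ (R - 1))

theorem bernoulliMajorant_nonneg (a R : ℝ) (n : ℕ) {u : ℝ} (hu : 0 < u) :
    0 ≤ bernoulliMajorant a R n u := by
  have := (one_sub_exp_neg_mem hu).1
  unfold bernoulliMajorant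
  positivity

theorem sum_bernoulliMajorant_le (a R : ℝ) {N : ℕ} (hN : 1 ≤ N) (k : ℕ) {u : ℝ} (hu : 0 < u) :
    ∑ n ∈ Finset.range k, bernoulliMajorant a R (n + N) u ≤
      Real.exp (-(a * u)) * u ^ ((N - R : ℝ) - 1) + Real.exp (-(a * u)) * u ^ ((N + R : ℝ) - 1) := by
  simp only [bernoulliMajorant]
  rw [← Finset.sum_mul, ← Finset.mul_sum]
  calc _ ≤ Real.exp (-(a * u)) * u ^ N * (u ^ (-R - 1) + u ^ (R - 1)) := by
        gcongr
        exact sum_one_sub_exp_neg_le hu hN k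
    _ = _ := by
        rw [show (N - R : ℝ) - 1 = N + (-R - 1) by ring, show (N + R : ℝ) - 1 = N + (R - 1) by ring,
          Real.rpow_add hu, Real.rpow_add hu, Real.rpow_natCast]
        ring

theorem measurable_bernoulliMajorant (a R : ℝ) (n : ℕ) : Measurable (bernoulliMajorant a R n) := by
  unfold bernoulliMajorant
  fun_prop

theorem integrableOn_bernoulliMajorant {a R : ℝ} (ha : 0 < a) (hR : 0 < R) {n : ℕ} (hn : R < n) :
    IntegrableOn (bernoulliMajorant a R n) (Ioi 0) := by
  have hn1 : 1 ≤ n := by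
    rw [Nat.one_le_iff_ne_zero]; rintro rfl; norm_num at hn; linarith
  have hG := (integrableOn_exp_neg_mul_rpow ha (σ := n - R) (by linarith)).add
    (integrableOn_exp_neg_mul_rpow ha (σ := n + R) (by positivity))
  refine Integrable.mono' hG (measurable_bernoulliMajorant a R n).aestronglyMeasurable ?_
  refine (ae_restrict_iff' measurableSet_Ioi).2 (ae_of_all _ fun u hu => ?_)
  rw [Real.norm_of_nonneg (bernoulliMajorant_nonneg a R n hu)]
  simpa using sum_bernoulliMajorant_le a R hn1 1 hu

theorem summable_integral_bernoulliMajorant {a R : ℝ} (ha : 0 < a) (hR : 0 < R) :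
    Summable fun n : ℕ => ∫ u in Ioi (0:ℝ), bernoulliMajorant a R n u := by
  obtain ⟨N, hN⟩ := exists_nat_gt R
  have hN1 : 1 ≤ N := by
    rw [Nat.one_le_iff_ne_zero]; rintro rfl; norm_num at hN; linarith
  rw [← summable_nat_add_iff N]
  have hG := (integrableOn_exp_neg_mul_rpow ha (σ := N - R) (by linarith)).add
    (integrableOn_exp_neg_mul_rpow ha (σ := N + R) (by positivity))
  have hint : ∀ n : ℕ, IntegrableOn (bernoulliMajorant a R (n + N)) (Ioi 0) := fun n =>
    integrableOn_bernoulliMajorant ha hR (by push_cast; linarith [n.cast_nonneg (α := ℝ)])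
  refine summable_of_sum_range_le
    (c := ∫ u in Ioi (0:ℝ), (Real.exp (-(a * u)) * u ^ ((N - R : ℝ) - 1) +
      Real.exp (-(a * u)) * u ^ ((N + R : ℝ) - 1)))
    (fun n => setIntegral_nonneg measurableSet_Ioi fun u hu => bernoulliMajorant_nonneg a R _ hu)
    fun k => ?_
  rw [← integral_finsetSum _ fun n _ => hint n]
  exact setIntegral_mono_on (integrable_finsetSum _ fun n _ => hint n) hG measurableSet_Ioi
    fun u hu => sum_bernoulliMajorant_le a R hN1 k hu

/-- The function whose Mellin transform represents `(−1)^n Δ^n f_{−z}(t)` up to `1/Γ(z)`. -/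
noncomputable def differenceKernel (φ : ℝ → ℂ) (t : ℝ) (n : ℕ) (u : ℝ) : ℂ :=
  ((Real.exp (-(t * u)) * (1 - Real.exp (-u)) ^ n : ℝ) : ℂ) * φ u

theorem measurable_differenceKernel {φ : ℝ → ℂ} (hφ : Measurable φ) (t : ℝ) (n : ℕ) :
    Measurable (differenceKernel φ t n) := by
  unfold differenceKernel
  fun_prop

section Kernel

variable {φ : ℝ → ℂ} {C a : ℝ}

theorem norm_differenceKernel_le (hb : ∀ u ∈ Ioi (0:ℝ), ‖φ u‖ ≤ C * Real.exp (a * u))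
    {t : ℝ} (ht : 2 * a ≤ t) (n : ℕ) {u : ℝ} (hu : 0 < u) :
    ‖differenceKernel φ t n u‖ ≤ C * (Real.exp (-(a * u)) * (1 - Real.exp (-u)) ^ n) := by
  have h0 := (one_sub_exp_neg_mem hu).1
  rw [differenceKernel, norm_mul, Complex.norm_real, Real.norm_of_nonneg (by positivity)]
  have hC : 0 ≤ C := by
    have := (norm_nonneg _).trans (hb u hu)
    exact nonneg_of_mul_nonneg_left this (Real.exp_pos _)
  calc Real.exp (-(t * u)) * (1 - Real.exp (-u)) ^ n * ‖φ u‖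
      ≤ Real.exp (-(2 * a * u)) * (1 - Real.exp (-u)) ^ n * (C * Real.exp (a * u)) := by
        gcongr
        exact hb u hu
    _ = C * (Real.exp (-(2 * a * u) + a * u) * (1 - Real.exp (-u)) ^ n) := by
        rw [Real.exp_add]; ring
    _ = _ := by ring_nf

theorem norm_differenceKernel_le_pow (hb : ∀ u ∈ Ioi (0:ℝ), ‖φ u‖ ≤ C * Real.exp (a * u))
    {t : ℝ} (ht : 2 * a ≤ t) (n : ℕ) :
    ∀ u ∈ Ioi (0:ℝ), ‖differenceKernel φ t n u‖ ≤ C * (u ^ n * Real.exp (-(a * u))) := by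
  intro u hu
  obtain ⟨h0, -, h2⟩ := one_sub_exp_neg_mem hu
  have hC : 0 ≤ C := by
    have := (norm_nonneg _).trans (hb u hu)
    exact nonneg_of_mul_nonneg_left this (Real.exp_pos _)
  refine (norm_differenceKernel_le hb ht n hu).trans ?_
  rw [mul_comm (u ^ n)]
  gcongr

theorem norm_cpow_le_of_abs_re_le {R : ℝ} {z : ℂ} (hz : |z.re| ≤ R) {u : ℝ} (hu : 0 < u) :
    ‖(u : ℂ) ^ (z - 1)‖ ≤ u ^ (-R - 1) + u ^ (R - 1) := by
  rw [Complex.norm_cpow_eq_rpow_re_of_pos hu, Complex.sub_re, Complex.one_re]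
  obtain ⟨h1, h2⟩ := abs_le.1 hz
  have p1 : 0 < u ^ (-R - 1) := Real.rpow_pos_of_pos hu _
  have p2 : 0 < u ^ (R - 1) := Real.rpow_pos_of_pos hu _
  rcases le_total u 1 with h | h
  · linarith [Real.rpow_le_rpow_of_exponent_ge hu h (show -R - 1 ≤ z.re - 1 by linarith)]
  · linarith [Real.rpow_le_rpow_of_exponent_le h (show z.re - 1 ≤ R - 1 by linarith)]

theorem integral_norm_differenceKernel_le (ha : 0 < a)
    (hb : ∀ u ∈ Ioi (0:ℝ), ‖φ u‖ ≤ C * Real.exp (a * u))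
    {t : ℝ} (ht : 2 * a ≤ t) {R : ℝ} (hR : 0 < R) {n : ℕ} (hn : R < n) {z : ℂ}
    (hz : |z.re| ≤ R) :
    (∫ u in Ioi (0:ℝ), ‖(u : ℂ) ^ (z - 1) • differenceKernel φ t n u‖) / ((n : ℝ) + 1) ≤
      C * ∫ u in Ioi (0:ℝ), bernoulliMajorant a R n u := by
  rw [← integral_div, ← integral_const_mul]
  refine integral_mono_of_nonneg (ae_of_all _ fun u => by positivity)
    ((integrableOn_bernoulliMajorant ha hR hn).const_mul C) ?_
  refine (ae_restrict_iff' measurableSet_Ioi).2 (ae_of_all _ fun u hu => ?_)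
  simp only
  have hu0 : (0:ℝ) < u := hu
  rw [norm_smul, div_le_iff₀ (by positivity)]
  refine (mul_le_mul (norm_cpow_le_of_abs_re_le hz hu) (norm_differenceKernel_le hb ht n hu)
    (norm_nonneg _) (by positivity)).trans_eq ?_
  unfold bernoulliMajorant
  field_simp

end Kernel

section Representation

variable {f : ℂ → ℝ → ℂ} {φ : ℝ → ℂ}

theorem mellinConvergent_differenceKernel (hφ : MemDLi φ) {t : ℝ} (ht : 0 < t) {n : ℕ} {z : ℂ}
    (hz : -(n : ℝ) < z.re) : MellinConvergent (differenceKernel φ t n) z := by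
  obtain ⟨C, -, hb⟩ := hφ.exists_norm_le_exp (half_pos ht)
  exact mellinConvergent_of_norm_le_exp (measurable_differenceKernel hφ.1.1 t n) (half_pos ht)
    (norm_differenceKernel_le_pow hb (by linarith) n) hz

theorem differentiableAt_mellin_differenceKernel (hφ : MemDLi φ) {t : ℝ} (ht : 0 < t) {n : ℕ}
    {z : ℂ} (hz : -(n : ℝ) < z.re) :
    DifferentiableAt ℂ (mellin (differenceKernel φ t n)) z := by
  obtain ⟨C, -, hb⟩ := hφ.exists_norm_le_exp (half_pos ht)
  exact differentiableAt_mellin_of_norm_le_exp (measurable_differenceKernel hφ.1.1 t n)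
    (half_pos ht) (norm_differenceKernel_le_pow hb (by linarith) n) hz

theorem differentiable_iterate_Dh (hf : ∀ t ∈ Ioi (0:ℝ), Differentiable ℂ fun s => f s t)
    (n : ℕ) : ∀ t ∈ Ioi (0:ℝ), Differentiable ℂ fun s => (Dh 1)^[n] (f s) t := by
  induction n with
  | zero => exact hf
  | succ n ih =>
    intro t ht
    simp only [Function.iterate_succ_apply', Dh]
    exact (ih (t + 1) (by simp only [mem_Ioi] at *; linarith)).sub (ih t ht)

theorem mellin_differenceKernel_succ (hφ : MemDLi φ) {t : ℝ} (ht : 0 < t) {n : ℕ} {z : ℂ}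
    (hz : -(n : ℝ) < z.re) :
    mellin (differenceKernel φ t (n + 1)) z =
      mellin (differenceKernel φ t n) z - mellin (differenceKernel φ (t + 1) n) z := by
  rw [← (hasMellin_sub (mellinConvergent_differenceKernel hφ ht hz)
    (mellinConvergent_differenceKernel hφ (by linarith : 0 < t + 1) hz)).2]
  congr 1
  funext u
  simp only [differenceKernel]
  rw [show -((t + 1) * u) = -(t * u) + -u by ring, Real.exp_add]
  push_cast
  ring

theorem LM_eq_mellin (φ : ℝ → ℂ) (z : ℂ) (t : ℝ) :
    LM φ z t = (Complex.Gamma z)⁻¹ * mellin (differenceKernel φ t 0) z := by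
  rw [LM, mellin, one_div]
  congr 1
  refine integral_congr_ae (ae_of_all _ fun u => ?_)
  simp only [differenceKernel, smul_eq_mul]
  push_cast
  ring

theorem iterate_Dh_eq_mellin_of_one_lt (hf : MemHwith f φ) {z : ℂ} (hz : 1 < z.re) (n : ℕ) :
    ∀ t ∈ Ioi (0:ℝ), (Dh 1)^[n] (f (-z)) t =
      (-1) ^ n * ((Complex.Gamma z)⁻¹ * mellin (differenceKernel φ t n) z) := by
  induction n with
  | zero =>
    intro t ht
    simp [hf.2.2.2.2.2 z hz t ht, LM_eq_mellin]
  | succ n ih =>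
    intro t ht
    have ht0 : (0:ℝ) < t := ht
    rw [Function.iterate_succ_apply', Dh, ih t ht, ih (t + 1) (add_pos ht0 one_pos),
      mellin_differenceKernel_succ hf.2.2.2.1 ht
        (by linarith [n.cast_nonneg (α := ℝ)] : -(n : ℝ) < z.re)]
    ring

theorem iterate_Dh_eq_mellin (hf : MemHwith f φ) {t : ℝ} (ht : 0 < t) {n : ℕ} {z : ℂ}
    (hz : -(n : ℝ) < z.re) :
    (Dh 1)^[n] (f (-z)) t =
      (-1) ^ n * ((Complex.Gamma z)⁻¹ * mellin (differenceKernel φ t n) z) := by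
  have hopen : IsOpen {w : ℂ | -(n : ℝ) < w.re} := isOpen_lt continuous_const Complex.continuous_re
  have hL : AnalyticOnNhd ℂ (fun w => (Dh 1)^[n] (f (-w)) t) {w : ℂ | -(n : ℝ) < w.re} :=
    fun w _ => ((differentiable_iterate_Dh hf.2.1 n t ht).comp differentiable_neg).analyticAt w
  have hRr : AnalyticOnNhd ℂ
      (fun w => (-1) ^ n * ((Complex.Gamma w)⁻¹ * mellin (differenceKernel φ t n) w))
      {w : ℂ | -(n : ℝ) < w.re} := by
    refine DifferentiableOn.analyticOnNhd (fun w hw => ?_) hopen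
    exact (((Complex.differentiable_one_div_Gamma w).mul
      (differentiableAt_mellin_differenceKernel hf.2.2.2.1 ht hw)).const_mul _).differentiableWithinAt
  refine hL.eqOn_of_preconnected_of_eventuallyEq hRr
    (convex_halfSpace_re_gt _).isPreconnected (z₀ := 2) ?_ ?_ hz
  · simp only [mem_ofPred_eq, Complex.re_ofNat]
    linarith [n.cast_nonneg (α := ℝ)]
  · filter_upwards [(isOpen_lt continuous_const Complex.continuous_re).mem_nhds
      (show (1:ℝ) < (2:ℂ).re by norm_num)] with w hw
    exact iterate_Dh_eq_mellin_of_one_lt hf hw n t ht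

theorem BTerm_eq_mellin (hf : MemHwith f φ) {t : ℝ} (ht : 0 < t) {n : ℕ} {z : ℂ}
    (hz : -(n : ℝ) < z.re) :
    BTerm 1 (f (-z)) n t =
      (Complex.Gamma z)⁻¹ * (mellin (differenceKernel φ t n) z / ((n : ℂ) + 1)) := by
  rw [BTerm, iterate_Dh_eq_mellin hf ht hz]
  have : ((-1 : ℂ) ^ n) * (-1) ^ n = 1 := by rw [← mul_pow]; simp
  linear_combination ((Complex.Gamma z)⁻¹ * mellin (differenceKernel φ t n) z / ((n : ℂ) + 1)) * this

theorem exists_summable_bound_BTerm (hf : MemHwith f φ) {t₀ : ℝ} (ht₀ : 0 < t₀) (R : ℝ) :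
    ∃ M : ℕ → ℝ, Summable M ∧ ∀ᶠ n in atTop, ∀ z : ℂ, ‖z‖ ≤ R → ∀ t, t₀ ≤ t →
      ‖BTerm 1 (f (-z)) n t‖ ≤ M n := by
  obtain ⟨C, -, hb⟩ := hf.2.2.2.1.exists_norm_le_exp (half_pos ht₀)
  obtain ⟨G, hG⟩ := (isCompact_closedBall (0 : ℂ) R).exists_bound_of_continuousOn
    Complex.differentiable_one_div_Gamma.continuous.continuousOn
  have hR' : 0 < max R 1 := lt_max_of_lt_right one_pos
  refine ⟨fun n => G * (C * ∫ u in Ioi (0:ℝ), bernoulliMajorant (t₀ / 2) (max R 1) n u),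
    ((summable_integral_bernoulliMajorant (half_pos ht₀) hR').mul_left C).mul_left G, ?_⟩
  obtain ⟨N, hN⟩ := exists_nat_gt (max R 1)
  filter_upwards [eventually_ge_atTop N] with n hn z hz t ht
  have hn' : max R 1 < n := hN.trans_le (by exact_mod_cast hn)
  have hzre : |z.re| ≤ max R 1 := (Complex.abs_re_le_norm z).trans (hz.trans (le_max_left _ _))
  have hG' := hG z (by simpa using hz)
  rw [BTerm_eq_mellin hf (ht₀.trans_le ht) (by linarith [(abs_le.1 hzre).1]), norm_mul, norm_div]
  refine mul_le_mul hG' ?_ (by positivity) ((norm_nonneg _).trans hG')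
  refine le_trans ?_ (integral_norm_differenceKernel_le (half_pos ht₀) hb
    (by linarith : 2 * (t₀ / 2) ≤ t) hR' hn' hzre)
  have : ‖(n : ℂ) + 1‖ = (n : ℝ) + 1 := by
    rw [← Nat.cast_succ, Complex.norm_natCast, Nat.cast_succ]
  rw [this]
  gcongr
  exact norm_integral_le_integral_norm _

theorem MemHwith.aLUOn_BTerm (hf : MemHwith f φ) (s : ℂ) : ALUOn (BTerm 1 (f s)) (Ioi 0) := by
  have key : ∀ t₀ : ℝ, 0 < t₀ → ∃ M : ℕ → ℝ, Summable M ∧ ∀ᶠ n in atTop, ∀ t ∈ Ici t₀,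
      ‖BTerm 1 (f s) n t‖ ≤ M n := by
    intro t₀ ht₀
    obtain ⟨M, hM, h⟩ := exists_summable_bound_BTerm hf ht₀ ‖-s‖
    refine ⟨M, hM, h.mono fun n hn t ht => ?_⟩
    simpa using hn (-s) le_rfl t ht
  refine ⟨fun t ht => ?_, fun V hV t ht => ?_⟩
  · obtain ⟨M, hM, h⟩ := key t ht
    exact Summable.of_norm_bounded_eventually_nat hM
      (h.mono fun n hn => by simpa using hn t self_mem_Ici)
  · have ht0 : (0:ℝ) < t := ht
    obtain ⟨M, hM, h⟩ := key (t / 2) (half_pos ht0)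
    exact ⟨Ici (t / 2), mem_nhdsWithin_of_mem_nhds (Ici_mem_nhds (half_lt_self ht0)),
      tendstoUniformlyOn_tsum_nat_eventually hM h V hV⟩

theorem differentiable_Bop (hf : MemHwith f φ) {t : ℝ} (ht : 0 < t) :
    Differentiable ℂ fun z => Bop 1 (f (-z)) t := by
  intro z
  obtain ⟨M, hM, h⟩ := exists_summable_bound_BTerm hf ht (‖z‖ + 1)
  have hlim : TendstoUniformlyOn
      (fun N w => ∑ n ∈ Finset.range N, BTerm 1 (f (-w)) n t)
      (fun w => ∑' n : ℕ, BTerm 1 (f (-w)) n t) atTop (Metric.ball 0 (‖z‖ + 1)) :=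
    tendstoUniformlyOn_tsum_nat_eventually hM
      (h.mono fun n hn w hw => hn w (by simpa using (mem_ball_zero_iff.1 hw).le) t le_rfl)
  refine (hlim.tendstoLocallyUniformlyOn.differentiableOn (Eventually.of_forall fun N => ?_)
    Metric.isOpen_ball).differentiableAt (Metric.isOpen_ball.mem_nhds (by simp))
  refine DifferentiableOn.fun_sum fun n _ => Differentiable.differentiableOn ?_
  simp only [BTerm]
  exact ((differentiable_iterate_Dh hf.2.1 n t ht).comp differentiable_neg).const_mul _

end Representation

/-- The function whose Mellin transform represents `(B f_{−z})(t)` up to `1/Γ(z)`. -/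
noncomputable def bernoulliKernel (φ : ℝ → ℂ) (t u : ℝ) : ℂ :=
  ((Real.exp (-(t * u)) * (u / (1 - Real.exp (-u))) : ℝ) : ℂ) * φ u

theorem measurable_bernoulliKernel {φ : ℝ → ℂ} (hφ : Measurable φ) (t : ℝ) :
    Measurable (bernoulliKernel φ t) := by
  unfold bernoulliKernel
  fun_prop

theorem div_one_sub_exp_neg_le {u : ℝ} (hu : 0 < u) : u / (1 - Real.exp (-u)) ≤ 1 + u := by
  rw [div_le_iff₀ (one_sub_exp_neg_mem hu).1]
  have h1 : (1 + u) * Real.exp (-u) ≤ Real.exp u * Real.exp (-u) := by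
    gcongr
    linarith [Real.add_one_le_exp u]
  rw [← Real.exp_add, add_neg_cancel, Real.exp_zero] at h1
  linarith

theorem mellinConvergent_bernoulliKernel {φ : ℝ → ℂ} (hφ : MemDLi φ) {t : ℝ} (ht : 0 < t) {z : ℂ}
    (hz : 0 < z.re) : MellinConvergent (bernoulliKernel φ t) z := by
  have ha : 0 < t / 4 := by positivity
  obtain ⟨C, hC, hb⟩ := hφ.exists_norm_le_exp (half_pos ht)
  refine mellinConvergent_of_norm_le_exp (n := 0) (C := C * (1 + 4 / t))
    (measurable_bernoulliKernel hφ.1.1 t) ha (fun u hu => ?_) (by simpa using hz)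
  have hu0 : (0:ℝ) < u := hu
  have h0 := (one_sub_exp_neg_mem hu).1
  rw [bernoulliKernel, norm_mul, Complex.norm_real, Real.norm_of_nonneg (by positivity)]
  have h1 : 1 + u ≤ (1 + 4 / t) * Real.exp (t / 4 * u) := by
    have h2 : (1 + 4 / t) * (t / 4 * u + 1) = 1 + u + (t / 4 * u + 4 / t) := by
      field_simp
      ring
    calc 1 + u ≤ (1 + 4 / t) * (t / 4 * u + 1) := by
          rw [h2]
          have : 0 < t / 4 * u + 4 / t := by positivity
          linarith
      _ ≤ _ := by
          gcongr
          exact Real.add_one_le_exp _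
  calc Real.exp (-(t * u)) * (u / (1 - Real.exp (-u))) * ‖φ u‖
      ≤ Real.exp (-(t * u)) * ((1 + 4 / t) * Real.exp (t / 4 * u)) *
          (C * Real.exp (t / 2 * u)) := by
        gcongr
        · exact (div_one_sub_exp_neg_le hu).trans h1
        · exact hb u hu
    _ = C * (1 + 4 / t) * Real.exp (-(t * u) + t / 4 * u + t / 2 * u) := by
        rw [Real.exp_add, Real.exp_add]
        ring
    _ = _ := by
        rw [pow_zero, one_mul]
        ring_nf

theorem hasSum_differenceKernel (φ : ℝ → ℂ) (t : ℝ) {u : ℝ} (hu : 0 < u) :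
    HasSum (fun n : ℕ => differenceKernel φ t n u / ((n : ℂ) + 1)) (bernoulliKernel φ t u) := by
  have h0 := (one_sub_exp_neg_mem hu).1
  have h1 : HasSum (fun n : ℕ => Real.exp (-(t * u)) * (1 - Real.exp (-u)) ^ n / ((n : ℝ) + 1))
      (Real.exp (-(t * u)) * (u / (1 - Real.exp (-u)))) := by
    refine (((hasSum_one_sub_exp_neg hu).div_const (1 - Real.exp (-u))).mul_left
      (Real.exp (-(t * u)))).congr_fun fun n => ?_
    rw [pow_succ]
    field_simp
  refine ((Complex.hasSum_ofReal.2 h1).mul_right (φ u)).congr_fun fun n => ?_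
  rw [differenceKernel]
  push_cast
  ring

theorem Bop_eq_mellin {f : ℂ → ℝ → ℂ} {φ : ℝ → ℂ} (hf : MemHwith f φ) {t : ℝ} (ht : 0 < t) {z : ℂ}
    (hz : 0 < z.re) :
    Bop 1 (f (-z)) t = (Complex.Gamma z)⁻¹ * mellin (bernoulliKernel φ t) z := by
  have hφ := hf.2.2.2.1
  have hn : ∀ n : ℕ, -(n : ℝ) < z.re := fun n => by linarith [n.cast_nonneg (α := ℝ)]
  have hnorm : ∀ n : ℕ, ‖(n : ℂ) + 1‖ = (n : ℝ) + 1 := fun n => by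
    rw [← Nat.cast_succ, Complex.norm_natCast, Nat.cast_succ]
  have hsum := hasSum_integral_of_summable_integral_norm (μ := volume.restrict (Ioi (0:ℝ)))
    (F := fun (n : ℕ) (u : ℝ) => (u : ℂ) ^ (z - 1) • differenceKernel φ t n u / ((n : ℂ) + 1))
    (fun n => Integrable.div_const (mellinConvergent_differenceKernel hφ ht (hn n)) _) (by
      obtain ⟨C, -, hb⟩ := hφ.exists_norm_le_exp (half_pos ht)
      refine Summable.of_norm_bounded_eventually_nat
        ((summable_integral_bernoulliMajorant (half_pos ht)
          (lt_of_lt_of_le hz (le_abs_self _))).mul_left C) ?_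
      obtain ⟨N, hN⟩ := exists_nat_gt |z.re|
      filter_upwards [eventually_ge_atTop N] with n hn
      rw [Real.norm_of_nonneg (integral_nonneg fun u => norm_nonneg _)]
      simp only [norm_div, hnorm]
      rw [integral_div]
      exact integral_norm_differenceKernel_le (half_pos ht) hb (by linarith)
        (lt_of_lt_of_le hz (le_abs_self _)) (hN.trans_le (by exact_mod_cast hn)) le_rfl)
  have hval : ∫ u in Ioi (0:ℝ), ∑' n : ℕ,
      (u : ℂ) ^ (z - 1) • differenceKernel φ t n u / ((n : ℂ) + 1) =
      mellin (bernoulliKernel φ t) z := by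
    refine setIntegral_congr_fun measurableSet_Ioi fun u hu => ?_
    have := ((hasSum_differenceKernel φ t hu).mul_left ((u : ℂ) ^ (z - 1))).tsum_eq
    simpa only [smul_eq_mul, mul_div_assoc] using this
  rw [hval] at hsum
  refine ((hsum.mul_left (Complex.Gamma z)⁻¹).congr_fun fun n => ?_).tsum_eq
  rw [BTerm_eq_mellin hf ht (hn n), integral_div, mellin]

section Dilation

theorem MemDL.comp_mul_left {φ : ℝ → ℂ} (h : MemDL φ) {c : ℝ} (hc : 0 < c) :
    MemDL fun u => φ (c * u) := by
  have hmeas : Measurable fun u => φ (c * u) := h.1.comp (measurable_const_mul c)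
  have hint : ∀ x > 0,
      IntegrableOn (fun u => Real.exp (-(x * u)) * ‖φ (c * u)‖) (Ioi 0) := fun x hx => by
    have := (integrableOn_Ioi_comp_mul_left_iff _ 0 hc).2
      (by simpa using h.2.2 (x / c) (by positivity))
    refine this.congr_fun (fun u _ => ?_) measurableSet_Ioi
    simp only
    congr 3
    field_simp
  refine ⟨hmeas, fun R hR => ?_, hint⟩
  refine Integrable.mono' (((hint 1 one_pos).mono_set Ioo_subset_Ioi_self).const_mul (Real.exp R))
    hmeas.aestronglyMeasurable
    ((ae_restrict_iff' measurableSet_Ioo).2 (ae_of_all _ fun u hu => ?_))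
  rw [← mul_assoc, ← Real.exp_add]
  exact le_mul_of_one_le_left (norm_nonneg _) (Real.one_le_exp (by linarith [hu.2]))

theorem MemDLi.comp_mul_left {φ : ℝ → ℂ} (h : MemDLi φ) {c : ℝ} (hc : 0 < c) :
    MemDLi fun u => φ (c * u) := by
  obtain ⟨h1, ψ, h2, h3, h4⟩ := h
  have hpos : ∀ u ∈ Ioi (0:ℝ), c * u ∈ Ioi (0:ℝ) := fun u hu => mul_pos hc hu
  exact ⟨h1.comp_mul_left hc, fun u => ψ (c * u), h2.comp_mul_left hc,
    fun u hu v hv huv => h3 (hpos u hu) (hpos v hv) (by gcongr), fun u hu => h4 _ (hpos u hu)⟩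

theorem mellin_eq_cpow_mul_mellin_comp (h : ℝ → ℂ) (z : ℂ) {c : ℝ} (hc : 0 < c) :
    mellin h z = (c : ℂ) ^ z * mellin (fun u => h (c * u)) z := by
  have hc0 : (c : ℂ) ≠ 0 := by exact_mod_cast hc.ne'
  rw [mellin_comp_mul_left h z hc, smul_eq_mul, ← mul_assoc, ← Complex.cpow_add _ _ hc0]
  simp

theorem LM_comp_mul_left (φ : ℝ → ℂ) (z : ℂ) (t : ℝ) {c : ℝ} (hc : 0 < c) :
    LM (fun u => φ (c⁻¹ * u)) z t = (c : ℂ) ^ z * LM φ z (c * t) := by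
  rw [LM_eq_mellin, LM_eq_mellin, mellin_eq_cpow_mul_mellin_comp _ z hc, mul_left_comm]
  congr 3
  funext u
  simp only [differenceKernel]
  rw [inv_mul_cancel_left₀ hc.ne', show c * t * u = t * (c * u) by ring]
  simp

theorem Lap_eq_LM_one (φ : ℝ → ℂ) (t : ℝ) : Lap φ t = LM φ 1 t := by
  simp [Lap, LM]

theorem MemHwith.dilate {f : ℂ → ℝ → ℂ} {φ : ℝ → ℂ} (hf : MemHwith f φ) {c : ℝ} (hc : 0 < c) :
    MemHwith (fun s u => (c : ℂ) ^ (-s) * f s (c * u)) fun u => φ (c⁻¹ * u) := by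
  obtain ⟨h1, h2, h3, h4, h5, h6⟩ := hf
  have hpos : ∀ u ∈ Ioi (0:ℝ), c * u ∈ Ioi (0:ℝ) := fun u hu => mul_pos hc hu
  have hc0 : (c : ℂ) ≠ 0 := by exact_mod_cast hc.ne'
  have hpow : Differentiable ℂ fun s : ℂ => (c : ℂ) ^ (-s) :=
    differentiable_neg.const_cpow (Or.inl hc0)
  have hcomp : ∀ s : ℂ, ∀ t ∈ Ioi (0:ℝ), DifferentiableAt ℝ (fun u => f s (c * u)) t :=
    fun s t ht => (h1 s (c * t) (hpos t ht)).comp t (differentiableAt_id.const_mul c)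
  refine ⟨fun s t ht => (hcomp s t ht).const_mul _, fun t ht => hpow.mul (h2 _ (hpos t ht)),
    fun t ht => ?_, h4.comp_mul_left (inv_pos.2 hc), fun t ht => ?_, fun s hs t ht => ?_⟩
  · have : (fun s => deriv (fun u => (c : ℂ) ^ (-s) * f s (c * u)) t) =
        fun s => (c : ℂ) ^ (-s) * (c • deriv (f s) (c * t)) := by
      funext s
      rw [deriv_const_mul _ (hcomp s t ht), deriv_comp_mul_left]
    rw [this]
    exact hpow.mul ((h3 _ (hpos t ht)).const_smul c)
  · simp only
    rw [Lap_eq_LM_one, LM_comp_mul_left φ 1 t hc, h5 _ (hpos t ht), Lap_eq_LM_one, neg_neg]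
  · simp only
    rw [LM_comp_mul_left φ s t hc, h6 s hs _ (hpos t ht), neg_neg]

end Dilation

theorem sum_exp_div_one_sub_exp_neg (t : ℝ) {m : ℕ} (hm : 1 ≤ m) {u : ℝ} (hu : 0 < u) :
    ∑ i ∈ Finset.range m, Real.exp (-((t + i) / m * (m * u))) *
        (m * u / (1 - Real.exp (-(m * u)))) =
      m * (Real.exp (-(t * u)) * (u / (1 - Real.exp (-u)))) := by
  have hm0 : (0:ℝ) < m := by exact_mod_cast hm
  have h1 := (one_sub_exp_neg_mem hu).1
  have h2 := (one_sub_exp_neg_mem (mul_pos hm0 hu)).1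
  have hexp : ∀ i : ℕ, Real.exp (-((t + i) / m * (m * u))) =
      Real.exp (-(t * u)) * Real.exp (-u) ^ i := fun i => by
    rw [← Real.exp_nat_mul, ← Real.exp_add]
    congr 1
    field_simp
    ring
  have hgeom : (∑ i ∈ Finset.range m, Real.exp (-u) ^ i) * (1 - Real.exp (-u)) =
      1 - Real.exp (-(m * u)) := by
    rw [geom_sum_mul_neg, ← Real.exp_nat_mul, mul_neg]
  simp only [hexp]
  rw [← Finset.sum_mul, ← Finset.mul_sum, ← hgeom]
  rw [← hgeom] at h2
  field_simp [left_ne_zero_of_mul h2.ne']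

theorem mellin_bernoulliKernel_multiplication {φ : ℝ → ℂ} (hφ : MemDLi φ) {t : ℝ} (ht : 0 < t)
    {m : ℕ} (hm : 1 ≤ m) {z : ℂ} (hz : 0 < z.re) :
    ∑ i ∈ Finset.range m,
        mellin (bernoulliKernel (fun u => φ ((m : ℝ)⁻¹ * u)) ((t + i) / m)) z =
      (m : ℂ) ^ z * (m * mellin (bernoulliKernel φ t) z) := by
  have hm0 : (0:ℝ) < m := by exact_mod_cast hm
  have hscale : ∀ i ∈ Finset.range m,
      mellin (bernoulliKernel (fun u => φ ((m : ℝ)⁻¹ * u)) ((t + i) / m)) z =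
        (m : ℂ) ^ z * mellin
          (fun u => bernoulliKernel (fun u => φ ((m : ℝ)⁻¹ * u)) ((t + i) / m) (m * u)) z :=
    fun i _ => by exact_mod_cast mellin_eq_cpow_mul_mellin_comp _ z hm0
  have hconv : ∀ i ∈ Finset.range m, MellinConvergent
      (fun u => bernoulliKernel (fun u => φ ((m : ℝ)⁻¹ * u)) ((t + i) / m) (m * u)) z :=
    fun i _ => (MellinConvergent.comp_mul_left hm0).2 (mellinConvergent_bernoulliKernel
      (hφ.comp_mul_left (inv_pos.2 hm0)) (by positivity) hz)
  rw [Finset.sum_congr rfl hscale, ← Finset.mul_sum]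
  simp only [mellin]
  rw [← integral_finsetSum _ hconv, ← integral_const_mul (m : ℂ)]
  congr 1
  refine setIntegral_congr_fun measurableSet_Ioi fun u hu => ?_
  have hs := congrArg (fun x : ℝ => (u : ℂ) ^ (z - 1) * ((x : ℂ) * φ u))
    (sum_exp_div_one_sub_exp_neg t hm hu)
  simp only [bernoulliKernel, smul_eq_mul, inv_mul_cancel_left₀ hm0.ne']
  rw [← Finset.mul_sum, ← Finset.sum_mul, ← Complex.ofReal_sum, hs, Complex.ofReal_mul,
    Complex.ofReal_natCast]
  ring

theorem Bop_multiplication_of_re_pos {f : ℂ → ℝ → ℂ} {φ : ℝ → ℂ} (hf : MemHwith f φ)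
    {m : ℕ} (hm : 1 ≤ m) {t : ℝ} (ht : 0 < t) {z : ℂ} (hz : 0 < z.re) :
    Bop 1 (f (-z)) t = ((m : ℂ) ^ (-z) / m) * ∑ i ∈ Finset.range m,
      Bop 1 (fun u => ((m : ℝ) : ℂ) ^ (- -z) * f (-z) (m * u)) ((t + i) / m) := by
  have hm0 : (0:ℝ) < m := by exact_mod_cast hm
  have hmC : (m : ℂ) ≠ 0 := by exact_mod_cast hm0.ne'
  have hsum := Finset.sum_congr (rfl : Finset.range m = Finset.range m) fun i _ =>
    Bop_eq_mellin (hf.dilate hm0) (show 0 < (t + (i : ℝ)) / m by positivity) hz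
  rw [hsum, ← Finset.mul_sum, mellin_bernoulliKernel_multiplication hf.2.2.2.1 ht hm hz,
    Bop_eq_mellin hf ht hz, Complex.cpow_neg]
  have : (m : ℂ) ^ z ≠ 0 := by simp [Complex.cpow_eq_zero_iff, hmC]
  field_simp

theorem Bop_multiplication {f : ℂ → ℝ → ℂ} {φ : ℝ → ℂ} (hf : MemHwith f φ)
    {m : ℕ} (hm : 1 ≤ m) {t : ℝ} (ht : 0 < t) (z : ℂ) :
    Bop 1 (f (-z)) t = ((m : ℂ) ^ (-z) / m) * ∑ i ∈ Finset.range m,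
      Bop 1 (fun u => ((m : ℝ) : ℂ) ^ (- -z) * f (-z) (m * u)) ((t + i) / m) := by
  have hm0 : (0:ℝ) < m := by exact_mod_cast hm
  have hmC : (m : ℂ) ≠ 0 := by exact_mod_cast hm0.ne'
  have hL := differentiable_Bop hf ht
  have hRr : Differentiable ℂ fun z : ℂ => ((m : ℂ) ^ (-z) / m) * ∑ i ∈ Finset.range m,
      Bop 1 (fun u => ((m : ℝ) : ℂ) ^ (- -z) * f (-z) (m * u)) ((t + i) / m) :=
    ((differentiable_neg.const_cpow (Or.inl hmC)).div_const _).mul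
      (Differentiable.fun_sum fun i _ =>
        differentiable_Bop (hf.dilate hm0) (show 0 < (t + (i : ℝ)) / m by positivity))
  refine congrFun (AnalyticOnNhd.eq_of_eventuallyEq (fun w _ => hL.analyticAt w)
    (fun w _ => hRr.analyticAt w) (z₀ := 1) ?_) z
  filter_upwards [(isOpen_lt continuous_const Complex.continuous_re).mem_nhds
    (show (0:ℝ) < (1:ℂ).re by norm_num)] with w hw
  exact Bop_multiplication_of_re_pos hf hm ht hw

/-- for `f ∈ ℋ` and an integer `m ≥ 1`, the function `g(s,u) = m^{−s} f(s, mu)`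
belongs to `ℋ`, all the Bernoulli series below converge absolutely and locally uniformly, and
`(B f_s)(t) = (m^s/m) Σ_{i=0}^{m−1} (B g_s)((t+i)/m)` for every `s ∈ ℂ` and `t > 0`. -/
theorem stmt14 (f : ℂ → ℝ → ℂ) (hf : MemH f) (m : ℕ) (hm : 1 ≤ m)
    (g : ℂ → ℝ → ℂ) (hg : g = fun s u => (m : ℂ) ^ (-s) * f s (m * u)) :
    MemH g ∧
    ∀ s : ℂ,
      ALUOn (BTerm 1 (f s)) (Ioi 0) ∧
      ALUOn (BTerm 1 (g s)) (Ioi 0) ∧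
      ∀ t ∈ Ioi (0:ℝ),
        Bop 1 (f s) t =
          ((m : ℂ) ^ s / m) * ∑ i ∈ Finset.range m, Bop 1 (g s) ((t + i) / m) := by
  obtain ⟨φ, hφ⟩ := hf
  have hm0 : (0:ℝ) < m := by exact_mod_cast hm
  have hgH : MemHwith g fun u => φ ((m : ℝ)⁻¹ * u) := by
    rw [hg]
    exact_mod_cast hφ.dilate hm0
  refine ⟨⟨_, hgH⟩, fun s => ⟨hφ.aLUOn_BTerm s, hgH.aLUOn_BTerm s, fun t ht => ?_⟩⟩
  have h := Bop_multiplication hφ hm ht (-s)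
  simp only [neg_neg, Complex.ofReal_natCast] at h
  rw [hg]
  exact h
end

section
/- Let f ∈ ℋ with f(−1,·) = ℒ(φ), and suppose |φ(u)| u^{−Re(γ)} → 0 as u → 0⁺ for some γ ∈ ℂ with Re(γ) > −1. Fix t₀ > 0, s ∈ ℂ with s ≠ 0, and an integer m ≥ 1, and set f^m(σ,t) = m^{−σ} f(σ, m t) (principal power; then f^m ∈ ℋ). For j ∈ {0,…,m−1} and integers n ≥ 0 define S_j(n) = (1/s)[(B f_s)(t₀+n) − m^s (B f^m_s)((t₀−1)/m + (n−j)/m + 1)] − (1/s)[(B f_s)(t₀) − m^s (B f^m_s)((t₀−1)/m + 1)], all Bernoulli series involved converging absolutely and locally uniformly. Then: (a) for every j ∈ {0,…,m−1} and every integer n ≥ j with n ≡ j (mod m), S_j(n) = Σ_{i=1}^{n} f(s−1, t₀+i−1) − m^s Σ_{i=1}^{(n−j)/m} f^m(s−1, (t₀−1)/m + i) = Σ_{i=1}^{n} f(s−1, t₀+i−1) − m·Σ_{i=1}^{(n−j)/m} f(s−1, t₀−1+mi); and (b) for every integer n ≥ 0, (1/m) Σ_{j=0}^{m−1} S_j(n)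 = −(1/s)[(B f_s)(t₀) − m^s (B f^m_s)((t₀−1)/m + 1)]; in particular the average (1/m) Σ_{j=0}^{m−1} S_j(n) is constant in n. -/
open MeasureTheory Filter Set

noncomputable section LaplaceMellin

/-- `|k(u)| ≤ C uᴺ (1 + u)` on `(0,∞)`, for a measurable kernel `k`. -/
def KernelBound (k : ℝ → ℝ) (N : ℕ) : Prop :=
  Measurable k ∧ ∃ C : ℝ, 0 ≤ C ∧ ∀ u : ℝ, 0 < u → |k u| ≤ C * (u ^ N * (1 + u))

/-- The absolute value of the integrand of `kernelLM`. -/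
def kernelLMAbs (φ : ℝ → ℂ) (k : ℝ → ℝ) (t p u : ℝ) : ℝ :=
  Real.exp (-(t * u)) * ‖φ u‖ * |k u| * u ^ p

/-- The integrand of `kernelLM`. -/
def kernelLMIntegrand (φ : ℝ → ℂ) (k : ℝ → ℝ) (t : ℝ) (s : ℂ) (u : ℝ) : ℂ :=
  Complex.exp (-(t * u : ℝ)) * φ u * k u * (u : ℂ) ^ (-s - 1)

/-- The unnormalised Laplace–Mellin transform `∫₀^∞ e^{−tu} φ(u) k(u) u^{−s−1} du`
with an additional kernel `k`. -/
def kernelLM (φ : ℝ → ℂ) (k : ℝ → ℝ) (t : ℝ) (s : ℂ) : ℂ :=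
  ∫ u in Ioi (0:ℝ), kernelLMIntegrand φ k t s u

theorem exists_rpow_le_exp {b c : ℝ} (hb : 0 ≤ b) (hc : 0 < c) :
    ∃ C : ℝ, ∀ u : ℝ, 0 < u → u ^ b ≤ C * Real.exp (c * u) := by
  rcases hb.eq_or_lt with rfl | hb
  · refine ⟨1, fun u hu => ?_⟩
    rw [Real.rpow_zero, one_mul]
    exact Real.one_le_exp (by positivity)
  · refine ⟨(b / c) ^ b, fun u hu => ?_⟩
    have h1 : c * u / b ≤ Real.exp (c * u / b) := by
      linarith [Real.add_one_le_exp (c * u / b)]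
    have h2 : (c * u / b) ^ b ≤ Real.exp (c * u) := by
      calc (c * u / b) ^ b ≤ Real.exp (c * u / b) ^ b :=
            Real.rpow_le_rpow (by positivity) h1 hb.le
        _ = Real.exp (c * u) := by rw [← Real.exp_mul]; congr 1; field_simp
    calc u ^ b = (b / c) ^ b * (c * u / b) ^ b := by
          rw [← Real.mul_rpow (by positivity) (by positivity)]; congr 1; field_simp
      _ ≤ _ := by gcongr

theorem integrableOn_exp_mul_norm_mul_rpow {φ : ℝ → ℂ} (hφ : MemDL φ) {t b : ℝ} (ht : 0 < t)
    (hb : 0 ≤ b) :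
    IntegrableOn (fun u => Real.exp (-(t * u)) * ‖φ u‖ * u ^ b) (Ioi 0) := by
  obtain ⟨C, hC⟩ := exists_rpow_le_exp hb (half_pos ht)
  have hm := hφ.1
  refine Integrable.mono' ((hφ.2.2 (t / 2) (half_pos ht)).const_mul C)
    (by fun_prop) ?_
  refine (ae_restrict_mem measurableSet_Ioi).mono fun u hu => ?_
  have hu' : 0 < u := hu
  rw [Real.norm_of_nonneg (by positivity)]
  calc Real.exp (-(t * u)) * ‖φ u‖ * u ^ b
      ≤ Real.exp (-(t * u)) * ‖φ u‖ * (C * Real.exp (t / 2 * u)) := by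
        gcongr; exact hC u hu
    _ = C * (Real.exp (-(t * u)) * Real.exp (t / 2 * u) * ‖φ u‖) := by ring
    _ = _ := by rw [← Real.exp_add]; ring_nf

theorem integrableOn_kernelLMAbs {φ : ℝ → ℂ} (hφ : MemDL φ) {k : ℝ → ℝ} {N : ℕ}
    (hk : KernelBound k N) {t p : ℝ} (ht : 0 < t) (hp : 0 ≤ N + p) :
    IntegrableOn (kernelLMAbs φ k t p) (Ioi 0) := by
  obtain ⟨hkm, C, hC0, hC⟩ := hk
  have hm := hφ.1
  refine Integrable.mono' (((integrableOn_exp_mul_norm_mul_rpow hφ ht hp).add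
    (integrableOn_exp_mul_norm_mul_rpow hφ ht (b := N + p + 1) (by linarith))).const_mul C)
    (by unfold kernelLMAbs; fun_prop) ?_
  refine (ae_restrict_mem measurableSet_Ioi).mono fun u hu => ?_
  have hu' : 0 < u := hu
  unfold kernelLMAbs
  rw [Real.norm_of_nonneg (by positivity)]
  calc Real.exp (-(t * u)) * ‖φ u‖ * |k u| * u ^ p
      ≤ Real.exp (-(t * u)) * ‖φ u‖ * (C * (u ^ N * (1 + u))) * u ^ p := by
        gcongr; exact hC u hu
    _ = _ := by
        simp only [Pi.add_apply]
        rw [Real.rpow_add hu' _ 1, Real.rpow_add hu', Real.rpow_natCast, Real.rpow_one]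
        ring

theorem norm_kernelLMIntegrand (φ : ℝ → ℂ) (k : ℝ → ℝ) (t : ℝ) (s : ℂ) {u : ℝ} (hu : 0 < u) :
    ‖kernelLMIntegrand φ k t s u‖ = kernelLMAbs φ k t (-s.re - 1) u := by
  simp [kernelLMIntegrand, kernelLMAbs, Complex.norm_exp, Complex.norm_cpow_eq_rpow_re_of_pos hu]

theorem measurable_kernelLMIntegrand {φ : ℝ → ℂ} (hφ : Measurable φ) {k : ℝ → ℝ}
    (hk : Measurable k) (t : ℝ) (s : ℂ) : Measurable (kernelLMIntegrand φ k t s) := by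
  unfold kernelLMIntegrand
  fun_prop

theorem integrableOn_kernelLMIntegrand {φ : ℝ → ℂ} (hφ : MemDL φ) {k : ℝ → ℝ} {N : ℕ}
    (hk : KernelBound k N) {t : ℝ} (ht : 0 < t) {s : ℂ} (hs : s.re ≤ N - 1) :
    IntegrableOn (kernelLMIntegrand φ k t s) (Ioi 0) := by
  refine Integrable.mono' (integrableOn_kernelLMAbs hφ hk ht (p := -s.re - 1) (by linarith))
    (measurable_kernelLMIntegrand hφ.1 hk.1 t s).aestronglyMeasurable ?_
  exact (ae_restrict_mem measurableSet_Ioi).mono fun u hu =>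
    (norm_kernelLMIntegrand φ k t s hu).le

theorem abs_log_mul_rpow_le {u a x ε : ℝ} (hu : 0 < u) (hε : 0 < ε) (hx : |x - a| ≤ ε) :
    |Real.log u| * u ^ x ≤ ε⁻¹ * (u ^ (a - 2 * ε) + u ^ (a + 2 * ε)) := by
  obtain ⟨h1, h2⟩ := abs_le.1 hx
  rcases le_total u 1 with h | h
  · have hl : |Real.log u| ≤ u ^ (-ε) / ε := by
      rw [abs_of_nonpos (Real.log_nonpos hu.le h), ← Real.log_inv]
      convert Real.log_le_rpow_div (inv_pos.2 hu).le hε using 2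
      rw [Real.rpow_neg hu.le, Real.inv_rpow hu.le]
    have hp : u ^ x ≤ u ^ (a - ε) := Real.rpow_le_rpow_of_exponent_ge hu h (by linarith)
    calc |Real.log u| * u ^ x ≤ u ^ (-ε) / ε * u ^ (a - ε) := by gcongr
      _ = ε⁻¹ * u ^ (a - 2 * ε) := by
        rw [show a - 2 * ε = -ε + (a - ε) by ring, Real.rpow_add hu (-ε)]; ring
      _ ≤ _ := by gcongr; linarith [Real.rpow_pos_of_pos hu (a + 2 * ε)]
  · have hl : |Real.log u| ≤ u ^ ε / ε := by
      rw [abs_of_nonneg (Real.log_nonneg h)]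
      exact Real.log_le_rpow_div hu.le hε
    have hp : u ^ x ≤ u ^ (a + ε) := Real.rpow_le_rpow_of_exponent_le h (by linarith)
    calc |Real.log u| * u ^ x ≤ u ^ ε / ε * u ^ (a + ε) := by gcongr
      _ = ε⁻¹ * u ^ (a + 2 * ε) := by
        rw [show a + 2 * ε = ε + (a + ε) by ring, Real.rpow_add hu ε]; ring
      _ ≤ _ := by gcongr; linarith [Real.rpow_pos_of_pos hu (a - 2 * ε)]

theorem differentiableAt_kernelLM {φ : ℝ → ℂ} (hφ : MemDL φ) {k : ℝ → ℝ} {N : ℕ}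
    (hk : KernelBound k N) {t : ℝ} (ht : 0 < t) {s : ℂ} (hs : s.re < N - 1) :
    DifferentiableAt ℂ (kernelLM φ k t) s := by
  set ε := (N - 1 - s.re) / 2 with hεd
  have hε : 0 < ε := by linarith
  have hb := ((integrableOn_kernelLMAbs hφ hk ht (p := (-s.re - 1) - 2 * ε) (by linarith)).add
    (integrableOn_kernelLMAbs hφ hk ht (p := (-s.re - 1) + 2 * ε) (by linarith))).const_mul ε⁻¹
  have hm : ∀ z, Measurable (kernelLMIntegrand φ k t z) :=
    measurable_kernelLMIntegrand hφ.1 hk.1 t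
  refine (hasDerivAt_integral_of_dominated_loc_of_deriv_le
    (μ := volume.restrict (Ioi (0:ℝ))) (Metric.ball_mem_nhds s hε)
    (F := fun z u => kernelLMIntegrand φ k t z u)
    (F' := fun z u => -(Real.log u : ℂ) * kernelLMIntegrand φ k t z u)
    (Eventually.of_forall fun z => (hm z).aestronglyMeasurable)
    (integrableOn_kernelLMIntegrand hφ hk ht hs.le) ?_ ?_ hb ?_).2.differentiableAt
  · have := hm s
    exact (by fun_prop : Measurable _).aestronglyMeasurable
  · refine (ae_restrict_mem measurableSet_Ioi).mono fun u hu z hz => ?_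
    have hu' : 0 < u := hu
    have hx : |(-z.re - 1) - (-s.re - 1)| ≤ ε := by
      rw [show (-z.re - 1) - (-s.re - 1) = -(z - s).re by simp; ring, abs_neg]
      exact (Complex.abs_re_le_norm _).trans (mem_ball_iff_norm.1 hz).le
    have := abs_log_mul_rpow_le hu' hε hx
    rw [norm_mul, norm_neg, Complex.norm_real, Real.norm_eq_abs,
      norm_kernelLMIntegrand φ k t z hu']
    simp only [Pi.add_apply, kernelLMAbs]
    calc |Real.log u| * (Real.exp (-(t * u)) * ‖φ u‖ * |k u| * u ^ (-z.re - 1))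
        = Real.exp (-(t * u)) * ‖φ u‖ * |k u| * (|Real.log u| * u ^ (-z.re - 1)) := by ring
      _ ≤ Real.exp (-(t * u)) * ‖φ u‖ * |k u| * _ :=
          mul_le_mul_of_nonneg_left this (by positivity)
      _ = _ := by ring
  · refine (ae_restrict_mem measurableSet_Ioi).mono fun u hu z _ => ?_
    have hu' : 0 < u := hu
    have h1 : HasDerivAt (fun z : ℂ => -z - 1) (-1) z := ((hasDerivAt_id z).neg).sub_const 1
    have h2 := (h1.const_cpow (c := (u : ℂ)) (Or.inl (by exact_mod_cast hu'.ne'))).const_mul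
      (Complex.exp (-(t * u : ℝ)) * φ u * k u)
    refine h2.congr_deriv ?_
    rw [kernelLMIntegrand, Complex.ofReal_log hu'.le]; ring

/-- The kernel of the `n`-th term of the Bernoulli series. -/
def bernKernel (n : ℕ) (u : ℝ) : ℝ := (1 - Real.exp (-u)) ^ n / (n + 1)

/-- The kernel `u / (1 − e^{−u})` of the Bernoulli operator. -/
def bernSumKernel (u : ℝ) : ℝ := u / (1 - Real.exp (-u))

/-- The kernel of the `N`-th tail of the Bernoulli series. -/
def bernTailKernel (N : ℕ) (u : ℝ) : ℝ :=
  bernSumKernel u - ∑ n ∈ Finset.range N, bernKernel n u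

theorem one_sub_exp_neg_pos {u : ℝ} (hu : 0 < u) : 0 < 1 - Real.exp (-u) := by
  rw [sub_pos, Real.exp_lt_one_iff]; linarith

theorem one_sub_exp_neg_le (u : ℝ) : 1 - Real.exp (-u) ≤ u := by
  linarith [Real.add_one_le_exp (-u)]

theorem bernKernel_nonneg (n : ℕ) {u : ℝ} (hu : 0 < u) : 0 ≤ bernKernel n u := by
  have := one_sub_exp_neg_pos hu
  unfold bernKernel; positivity

theorem hasSum_bernKernel {u : ℝ} (hu : 0 < u) :
    HasSum (fun n => bernKernel n u) (bernSumKernel u) := by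
  have hp := one_sub_exp_neg_pos hu
  have h := Real.hasSum_pow_div_log_of_abs_lt_one (x := 1 - Real.exp (-u))
    (by rw [abs_of_pos hp]; linarith [Real.exp_pos (-u)])
  have h2 := h.div_const (1 - Real.exp (-u))
  have h3 : -Real.log (1 - (1 - Real.exp (-u))) / (1 - Real.exp (-u)) = bernSumKernel u := by
    simp [bernSumKernel]
  rw [h3] at h2
  refine h2.congr_fun fun n => ?_
  rw [bernKernel, pow_succ]
  field_simp

theorem hasSum_bernKernel_add (N : ℕ) {u : ℝ} (hu : 0 < u) :
    HasSum (fun n => bernKernel (n + N) u) (bernTailKernel N u) :=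
  (hasSum_nat_add_iff' N).2 (hasSum_bernKernel hu)

theorem bernSumKernel_le {u : ℝ} (hu : 0 < u) : bernSumKernel u ≤ 1 + u := by
  unfold bernSumKernel
  rw [div_le_iff₀ (one_sub_exp_neg_pos hu)]
  have h := Real.add_one_le_exp u
  have h2 : Real.exp (-u) * Real.exp u = 1 := by rw [← Real.exp_add]; simp
  nlinarith [Real.exp_pos (-u)]

theorem kernelBound_bernKernel (n : ℕ) : KernelBound (bernKernel n) n := by
  refine ⟨by unfold bernKernel; fun_prop, 1, zero_le_one, fun u hu => ?_⟩
  rw [abs_of_nonneg (bernKernel_nonneg n hu), one_mul]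
  unfold bernKernel
  have hp := one_sub_exp_neg_pos hu
  have h1 : (1 - Real.exp (-u)) ^ n ≤ u ^ n := pow_le_pow_left₀ hp.le (one_sub_exp_neg_le u) n
  calc (1 - Real.exp (-u)) ^ n / (n + 1) ≤ (1 - Real.exp (-u)) ^ n :=
        div_le_self (by positivity) (by linarith [(Nat.cast_nonneg n : (0:ℝ) ≤ n)])
    _ ≤ u ^ n * 1 := by rwa [mul_one]
    _ ≤ _ := by gcongr; linarith

theorem kernelBound_bernTailKernel (N : ℕ) : KernelBound (bernTailKernel N) N := by
  refine ⟨by unfold bernTailKernel bernSumKernel bernKernel; fun_prop, 1, zero_le_one,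
    fun u hu => ?_⟩
  have hs := hasSum_bernKernel_add N hu
  have hp := one_sub_exp_neg_pos hu
  rw [abs_of_nonneg (hs.nonneg fun n => bernKernel_nonneg _ hu), one_mul]
  have h1 : bernTailKernel N u ≤ (1 - Real.exp (-u)) ^ N * bernSumKernel u := by
    refine hasSum_le (fun n => ?_) hs ((hasSum_bernKernel hu).mul_left _)
    unfold bernKernel
    rw [pow_add, mul_comm, mul_div_assoc]
    gcongr
    linarith
  refine h1.trans ?_
  have h0 : 0 ≤ bernSumKernel u := div_nonneg hu.le hp.le
  exact mul_le_mul (pow_le_pow_left₀ hp.le (one_sub_exp_neg_le u) N) (bernSumKernel_le hu) h0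
    (by positivity)

theorem bernTailKernel_zero : bernTailKernel 0 = bernSumKernel := by
  ext
  simp [bernTailKernel]

theorem kernelBound_bernSumKernel : KernelBound bernSumKernel 0 :=
  bernTailKernel_zero ▸ kernelBound_bernTailKernel 0

theorem hasSum_kernelLMAbs (φ : ℝ → ℂ) (N : ℕ) (t p : ℝ) {u : ℝ} (hu : 0 < u) :
    HasSum (fun n => kernelLMAbs φ (bernKernel (n + N)) t p u)
      (kernelLMAbs φ (bernTailKernel N) t p u) := by
  have hs := hasSum_bernKernel_add N hu
  have h := (hs.mul_left (Real.exp (-(t * u)) * ‖φ u‖)).mul_right (u ^ p)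
  simp only [kernelLMAbs, abs_of_nonneg (bernKernel_nonneg _ hu),
    abs_of_nonneg (hs.nonneg fun n => bernKernel_nonneg _ hu)]
  exact h

theorem integrable_tsum_kernelLMAbs {φ : ℝ → ℂ} (hφ : MemDL φ) {N : ℕ} {t p : ℝ} (ht : 0 < t)
    (hp : 0 ≤ N + p) :
    IntegrableOn (fun u => ∑' n, kernelLMAbs φ (bernKernel (n + N)) t p u) (Ioi 0) :=
  (integrableOn_kernelLMAbs hφ (kernelBound_bernTailKernel N) ht hp).congr_fun
    (fun _ hu => (hasSum_kernelLMAbs φ N t p hu).tsum_eq.symm) measurableSet_Ioi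

theorem summable_integral_kernelLMAbs {φ : ℝ → ℂ} (hφ : MemDL φ) {N : ℕ} {t p : ℝ} (ht : 0 < t)
    (hp : 0 ≤ N + p) :
    Summable fun n => ∫ u in Ioi (0:ℝ), kernelLMAbs φ (bernKernel (n + N)) t p u := by
  refine (hasSum_integral_of_dominated_convergence
    (fun n => kernelLMAbs φ (bernKernel (n + N)) t p) (fun n => ?_) (fun n => ?_) ?_
    (integrable_tsum_kernelLMAbs hφ ht hp)
    ((ae_restrict_mem measurableSet_Ioi).mono fun u hu => hasSum_kernelLMAbs φ N t p hu)).summable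
  · exact (integrableOn_kernelLMAbs hφ (kernelBound_bernKernel (n + N)) ht
      (by push_cast; linarith [(Nat.cast_nonneg n : (0:ℝ) ≤ n)])).aestronglyMeasurable
  · refine (ae_restrict_mem measurableSet_Ioi).mono fun u hu => ?_
    have hu' : 0 < u := hu
    rw [Real.norm_of_nonneg (by unfold kernelLMAbs; positivity)]
  · exact (ae_restrict_mem measurableSet_Ioi).mono fun u hu =>
      (hasSum_kernelLMAbs φ N t p hu).summable

theorem hasSum_kernelLM {φ : ℝ → ℂ} (hφ : MemDL φ) {N : ℕ} {t : ℝ} (ht : 0 < t)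
    {s : ℂ} (hs : s.re ≤ N - 1) :
    HasSum (fun n => kernelLM φ (bernKernel (n + N)) t s) (kernelLM φ (bernTailKernel N) t s) := by
  refine hasSum_integral_of_dominated_convergence
    (fun n => kernelLMAbs φ (bernKernel (n + N)) t (-s.re - 1))
    (fun n => (measurable_kernelLMIntegrand hφ.1
      (kernelBound_bernKernel (n + N)).1 t s).aestronglyMeasurable)
    (fun n => (ae_restrict_mem measurableSet_Ioi).mono fun u hu =>
      (norm_kernelLMIntegrand φ _ t s hu).le)
    ((ae_restrict_mem measurableSet_Ioi).mono fun u hu =>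
      (hasSum_kernelLMAbs φ N t _ hu).summable)
    (integrable_tsum_kernelLMAbs hφ ht (by linarith)) ?_
  refine (ae_restrict_mem measurableSet_Ioi).mono fun u hu => ?_
  exact ((Complex.hasSum_ofReal.2 (hasSum_bernKernel_add N hu)).mul_left _).mul_right _

theorem kernelLM_bernSumKernel_add_one (hφ : MemDL φ) {s : ℂ} (hs : s.re < -1) {t : ℝ}
    (ht : 0 < t) :
    kernelLM φ bernSumKernel (t + 1) s - kernelLM φ bernSumKernel t s =
      -kernelLM φ (fun _ => 1) t (s - 1) := by
  have hs' : s.re ≤ (0 : ℕ) - 1 := by simpa using hs.le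
  unfold kernelLM
  rw [← integral_sub (integrableOn_kernelLMIntegrand hφ kernelBound_bernSumKernel (by linarith) hs')
      (integrableOn_kernelLMIntegrand hφ kernelBound_bernSumKernel ht hs'), ← integral_neg]
  refine setIntegral_congr_fun measurableSet_Ioi fun u hu => ?_
  have hu' : 0 < u := hu
  have e : Complex.exp (-((t + 1) * u : ℝ)) = Complex.exp (-(t * u : ℝ)) * Complex.exp (-u) := by
    rw [← Complex.exp_add]; push_cast; ring_nf
  have h1 : (1 : ℂ) - Complex.exp (-u) ≠ 0 := by
    exact_mod_cast (one_sub_exp_neg_pos hu').ne'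
  have h2 : (u : ℂ) ^ (-(s - 1) - 1) = u ^ (-s - 1) * u := by
    rw [show -(s - 1) - 1 = (-s - 1) + 1 by ring,
      Complex.cpow_add _ _ (by exact_mod_cast hu'.ne'), Complex.cpow_one]
  simp only [kernelLMIntegrand, bernSumKernel, e, h2]
  push_cast
  field_simp
  ring

theorem eq_of_eqOn_re_lt {F G : ℂ → ℂ} {c : ℝ} (hc : -1 ≤ c)
    (hF : ∀ s : ℂ, s.re < c → DifferentiableAt ℂ F s)
    (hG : ∀ s : ℂ, s.re < c → DifferentiableAt ℂ G s)
    (h : ∀ s : ℂ, s.re < -1 → F s = G s) {s : ℂ} (hs : s.re < c) : F s = G s := by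
  have hU : IsOpen {z : ℂ | z.re < c} := isOpen_lt Complex.continuous_re continuous_const
  have hV : IsOpen {z : ℂ | z.re < -1} := isOpen_lt Complex.continuous_re continuous_const
  have hFa : AnalyticOnNhd ℂ F {z : ℂ | z.re < c} :=
    DifferentiableOn.analyticOnNhd (fun z hz => (hF z hz).differentiableWithinAt) hU
  have hGa : AnalyticOnNhd ℂ G {z : ℂ | z.re < c} :=
    DifferentiableOn.analyticOnNhd (fun z hz => (hG z hz).differentiableWithinAt) hU
  have hconn : IsPreconnected {z : ℂ | z.re < c} :=
    (convex_halfSpace_re_lt c).isPreconnected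
  refine hFa.eqOn_of_preconnected_of_eventuallyEq hGa hconn (z₀ := -2) ?_ ?_ hs
  · simp only [mem_ofPred_eq, Complex.neg_re, Complex.re_ofNat]; linarith
  · filter_upwards [hV.mem_nhds (by norm_num : (-2 : ℂ) ∈ {z : ℂ | z.re < -1})] with z hz
    exact h z hz

theorem differentiable_inv_Gamma_neg : Differentiable ℂ fun s : ℂ => (Complex.Gamma (-s))⁻¹ :=
  Complex.differentiable_one_div_Gamma.comp differentiable_neg

namespace MemHwith

variable {f : ℂ → ℝ → ℂ} {φ : ℝ → ℂ}

theorem memDL (hf : MemHwith f φ) : MemDL φ := hf.2.2.2.1.1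

theorem apply_eq (hf : MemHwith f φ) {s : ℂ} (hs : s.re < -1) {t : ℝ} (ht : 0 < t) :
    f s t = (Complex.Gamma (-s))⁻¹ * kernelLM φ (fun _ => 1) t s := by
  have h := hf.2.2.2.2.2 (-s) (by rw [Complex.neg_re]; linarith) t ht
  rw [neg_neg] at h
  rw [h, LM, one_div]
  simp [kernelLM, kernelLMIntegrand]

theorem iterate_Dh_eq_of_re_lt_neg_one (hf : MemHwith f φ) {s : ℂ} (hs : s.re < -1) (n : ℕ) :
    ∀ {t : ℝ}, 0 < t → (Dh 1)^[n] (f s) t =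
      (-1) ^ n * (n + 1) * ((Complex.Gamma (-s))⁻¹ * kernelLM φ (bernKernel n) t s) := by
  induction n with
  | zero =>
    intro t ht
    have : bernKernel 0 = fun _ => 1 := by ext; simp [bernKernel]
    simp [this, hf.apply_eq hs ht]
  | succ n ih =>
    intro t ht
    have ht1 : 0 < t + 1 := by linarith
    have hs' : s.re ≤ n - 1 := by linarith [(Nat.cast_nonneg n : (0:ℝ) ≤ n)]
    have key : ((n : ℂ) + 1) * (kernelLM φ (bernKernel n) (t + 1) s - kernelLM φ (bernKernel n) t s)
        = -((n : ℂ) + 1 + 1) * kernelLM φ (bernKernel (n + 1)) t s := by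
      unfold kernelLM
      rw [← integral_sub
        (integrableOn_kernelLMIntegrand hf.memDL (kernelBound_bernKernel n) ht1 hs')
        (integrableOn_kernelLMIntegrand hf.memDL (kernelBound_bernKernel n) ht hs'),
        ← integral_const_mul, ← integral_const_mul]
      congr 1 with u
      have e : Complex.exp (-((t + 1) * u : ℝ)) = Complex.exp (-(t * u : ℝ)) * Complex.exp (-u) := by
        rw [← Complex.exp_add]; push_cast; ring_nf
      have h1 : (n : ℂ) + 1 ≠ 0 := Nat.cast_add_one_ne_zero n
      have h2 : (n : ℂ) + 1 + 1 ≠ 0 := by exact_mod_cast (Nat.succ_ne_zero (n + 1))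
      simp only [kernelLMIntegrand, bernKernel, e]
      push_cast
      field_simp
      ring
    rw [Function.iterate_succ_apply', Dh, ih ht1, ih ht]
    push_cast
    linear_combination (-1) ^ n * (Complex.Gamma (-s))⁻¹ * key

theorem differentiable_iterate_Dh (hf : MemHwith f φ) (n : ℕ) :
    ∀ {t : ℝ}, 0 < t → Differentiable ℂ fun s => (Dh 1)^[n] (f s) t := by
  induction n with
  | zero => exact fun ht => hf.2.1 _ ht
  | succ n ih =>
    intro t ht
    simp only [Function.iterate_succ_apply', Dh]
    exact (ih (by linarith)).sub (ih ht)

theorem BTerm_eq (hf : MemHwith f φ) {n : ℕ} {s : ℂ} (hs : s.re < n - 1) {t : ℝ} (ht : 0 < t) :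
    BTerm 1 (f s) n t = (Complex.Gamma (-s))⁻¹ * kernelLM φ (bernKernel n) t s := by
  have h1 : (n : ℂ) + 1 ≠ 0 := Nat.cast_add_one_ne_zero n
  have h := eq_of_eqOn_re_lt (c := n - 1) (F := fun s => (Dh 1)^[n] (f s) t)
    (by linarith [(Nat.cast_nonneg n : (0:ℝ) ≤ n)])
    (fun z _ => hf.differentiable_iterate_Dh n ht z)
    (fun z hz => ((differentiable_inv_Gamma_neg z).mul
      (differentiableAt_kernelLM hf.memDL (kernelBound_bernKernel n) ht hz)).const_mul
        ((-1 : ℂ) ^ n * (n + 1)))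
    (fun z hz => hf.iterate_Dh_eq_of_re_lt_neg_one hz n ht) hs
  have h2 : ((-1 : ℂ) ^ n) * (-1) ^ n = 1 := by rw [← mul_pow]; simp
  rw [BTerm, h, Pi.mul_apply]
  field_simp
  linear_combination ((Complex.Gamma (-s))⁻¹ * kernelLM φ (bernKernel n) t s) * h2

theorem differentiable_BTerm (hf : MemHwith f φ) (n : ℕ) {t : ℝ} (ht : 0 < t) :
    Differentiable ℂ fun s => BTerm 1 (f s) n t :=
  (hf.differentiable_iterate_Dh n ht).const_mul _

theorem hasSum_BTerm_add (hf : MemHwith f φ) {N : ℕ} {s : ℂ} (hs : s.re < N - 1) {t : ℝ}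
    (ht : 0 < t) :
    HasSum (fun n => BTerm 1 (f s) (n + N) t)
      ((Complex.Gamma (-s))⁻¹ * kernelLM φ (bernTailKernel N) t s) := by
  refine ((hasSum_kernelLM hf.memDL ht hs.le).mul_left _).congr_fun fun n => ?_
  exact hf.BTerm_eq (by push_cast; linarith [(Nat.cast_nonneg n : (0:ℝ) ≤ n)]) ht

theorem Bop_eq (hf : MemHwith f φ) {N : ℕ} {s : ℂ} (hs : s.re < N - 1) {t : ℝ} (ht : 0 < t) :
    Bop 1 (f s) t = (∑ n ∈ Finset.range N, BTerm 1 (f s) n t) +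
      (Complex.Gamma (-s))⁻¹ * kernelLM φ (bernTailKernel N) t s := by
  have h := (hasSum_nat_add_iff (f := fun n => BTerm 1 (f s) n t) N).1 (hf.hasSum_BTerm_add hs ht)
  rw [Bop, h.tsum_eq, add_comm]

theorem Bop_eq_of_re_lt_neg_one (hf : MemHwith f φ) {s : ℂ} (hs : s.re < -1) {t : ℝ}
    (ht : 0 < t) : Bop 1 (f s) t = (Complex.Gamma (-s))⁻¹ * kernelLM φ bernSumKernel t s := by
  have h := hf.Bop_eq (N := 0) (s := s) (by simpa using hs) ht
  simpa [bernTailKernel_zero] using h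

theorem differentiable_Bop (hf : MemHwith f φ) {t : ℝ} (ht : 0 < t) :
    Differentiable ℂ fun s => Bop 1 (f s) t := by
  intro s
  obtain ⟨N, hN⟩ := exists_nat_gt (s.re + 1)
  have hsN : s.re < N - 1 := by linarith
  have hd : DifferentiableAt ℂ (fun s => (∑ n ∈ Finset.range N, BTerm 1 (f s) n t) +
      (Complex.Gamma (-s))⁻¹ * kernelLM φ (bernTailKernel N) t s) s :=
    (DifferentiableAt.fun_sum fun n _ => hf.differentiable_BTerm n ht s).add
      ((differentiable_inv_Gamma_neg s).mul
        (differentiableAt_kernelLM hf.memDL (kernelBound_bernTailKernel N) ht hsN))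
  refine hd.congr_of_eventuallyEq ?_
  filter_upwards [(isOpen_lt Complex.continuous_re continuous_const).mem_nhds hsN] with z hz
  exact hf.Bop_eq hz ht

theorem exists_summable_bound_s15 (hf : MemHwith f φ) (s : ℂ) {a : ℝ} (ha : 0 < a) :
    ∃ N : ℕ, ∃ b : ℕ → ℝ, Summable b ∧ ∀ n, ∀ t, a ≤ t → ‖BTerm 1 (f s) (n + N) t‖ ≤ b n := by
  obtain ⟨N, hN⟩ := exists_nat_gt (s.re + 1)
  refine ⟨N, _, (summable_integral_kernelLMAbs hf.memDL (N := N) (p := -s.re - 1) ha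
    (by linarith)).mul_left ‖(Complex.Gamma (-s))⁻¹‖, fun n t hat => ?_⟩
  have hn : (0:ℝ) ≤ n := Nat.cast_nonneg n
  have ht : 0 < t := ha.trans_le hat
  rw [hf.BTerm_eq (by push_cast; linarith) ht, norm_mul]
  gcongr
  refine norm_integral_le_of_norm_le (integrableOn_kernelLMAbs hf.memDL
    (kernelBound_bernKernel (n + N)) ha (by push_cast; linarith)) ?_
  refine (ae_restrict_mem measurableSet_Ioi).mono fun u hu => ?_
  have hu' : 0 < u := hu
  rw [norm_kernelLMIntegrand _ _ _ _ hu', kernelLMAbs, kernelLMAbs]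
  gcongr

theorem ALUOn_BTerm (hf : MemHwith f φ) (s : ℂ) : ALUOn (BTerm 1 (f s)) (Ioi 0) := by
  refine ⟨fun t ht => ?_, ?_⟩
  · obtain ⟨N, b, hb, hle⟩ := hf.exists_summable_bound_s15 s (a := t) ht
    exact (summable_nat_add_iff N).1
      (Summable.of_nonneg_of_le (fun _ => norm_nonneg _) (fun n => hle n t le_rfl) hb)
  · refine tendstoLocallyUniformlyOn_of_forall_exists_nhds fun t ht => ?_
    have ht' : 0 < t := ht
    obtain ⟨N, b, hb, hle⟩ := hf.exists_summable_bound_s15 s (half_pos ht')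
    refine ⟨Ici (t / 2), mem_nhdsWithin_of_mem_nhds (Ici_mem_nhds (half_lt_self ht')), ?_⟩
    refine tendstoUniformlyOn_tsum_nat_eventually
      (u := fun n => b (n - N)) ((summable_nat_add_iff N).1 (by simpa using hb)) ?_
    filter_upwards [eventually_ge_atTop N] with n hn x hx
    have := hle (n - N) x hx
    rwa [Nat.sub_add_cancel hn] at this

theorem Bop_add_one_sub (hf : MemHwith f φ) (s : ℂ) {t : ℝ} (ht : 0 < t) :
    Bop 1 (f s) (t + 1) - Bop 1 (f s) t = s * f (s - 1) t := by
  have ht1 : 0 < t + 1 := by linarith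
  refine eq_of_eqOn_re_lt (c := max (-1) (s.re + 1)) (le_max_left _ _)
    (F := fun s => Bop 1 (f s) (t + 1) - Bop 1 (f s) t) (G := fun s => s * f (s - 1) t)
    (fun z _ => ((hf.differentiable_Bop ht1) z).sub ((hf.differentiable_Bop ht) z))
    (fun z _ => differentiableAt_id.mul
      (((hf.2.1 t ht).comp (differentiable_id.sub_const 1)) z)) (fun z hz => ?_)
    (lt_max_of_lt_right (by linarith))
  have hz0 : -z ≠ 0 := by
    rintro h
    rw [neg_eq_zero] at h
    simp [h] at hz
    linarith
  have hz1 : (z - 1).re < -1 := by simp; linarith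
  rw [hf.Bop_eq_of_re_lt_neg_one hz ht1, hf.Bop_eq_of_re_lt_neg_one hz ht, ← mul_sub,
    kernelLM_bernSumKernel_add_one hf.memDL hz ht, hf.apply_eq hz1 ht,
    show -(z - 1) = -z + 1 by ring, Complex.Gamma_add_one _ hz0, mul_inv]
  have : z ≠ 0 := neg_ne_zero.1 hz0
  field_simp

theorem Bop_add_nat_sub (hf : MemHwith f φ) (s : ℂ) {t : ℝ} (ht : 0 < t) (n : ℕ) :
    Bop 1 (f s) (t + n) - Bop 1 (f s) t = s * ∑ i ∈ Finset.range n, f (s - 1) (t + i) := by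
  induction n with
  | zero => simp
  | succ n ih =>
    have h := hf.Bop_add_one_sub s (t := t + n) (by positivity)
    rw [Finset.sum_range_succ, mul_add, ← ih, ← h]
    push_cast
    rw [add_assoc]
    ring

end MemHwith

theorem MemDL.of_integrableOn {φ : ℝ → ℂ} (hm : Measurable φ)
    (h : ∀ x > 0, IntegrableOn (fun u => Real.exp (-(x * u)) * ‖φ u‖) (Ioi 0)) : MemDL φ := by
  refine ⟨hm, fun R _ => ?_, h⟩
  refine Integrable.mono' (((h 1 one_pos).mono_set Ioo_subset_Ioi_self).const_mul (Real.exp R))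
    hm.aestronglyMeasurable ?_
  refine (ae_restrict_mem measurableSet_Ioo).mono fun u hu => ?_
  rw [← mul_assoc, ← Real.exp_add]
  exact le_mul_of_one_le_left (norm_nonneg _) (Real.one_le_exp (by linarith [hu.2]))

theorem MemDL.comp_div {φ : ℝ → ℂ} (hφ : MemDL φ) {a : ℝ} (ha : 0 < a) :
    MemDL fun u => φ (u / a) := by
  refine MemDL.of_integrableOn (hφ.1.comp (by fun_prop)) fun x hx => ?_
  have h := (integrableOn_Ioi_comp_mul_left_iff
    (fun u => Real.exp (-(x * a * u)) * ‖φ u‖) 0 (inv_pos.2 ha)).2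
    (by rw [mul_zero]; exact hφ.2.2 (x * a) (by positivity))
  refine h.congr_fun (fun u _ => ?_) measurableSet_Ioi
  beta_reduce
  rw [mul_assoc x a, mul_inv_cancel_left₀ ha.ne', div_eq_inv_mul]

theorem kernelLM_comp_div (φ : ℝ → ℂ) (k : ℝ → ℝ) (t : ℝ) (s : ℂ) {a : ℝ} (ha : 0 < a) :
    kernelLM (fun u => φ (u / a)) (fun u => k (u / a)) t s =
      (a : ℂ) ^ (-s) * kernelLM φ k (a * t) s := by
  have ha' : (a : ℂ) ≠ 0 := by exact_mod_cast ha.ne'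
  have h := integral_comp_mul_left_Ioi
    (kernelLMIntegrand (fun u => φ (u / a)) (fun u => k (u / a)) t s) 0 ha
  rw [mul_zero] at h
  have h2 : ∫ u in Ioi (0:ℝ),
      kernelLMIntegrand (fun u => φ (u / a)) (fun u => k (u / a)) t s (a * u) =
      (a : ℂ) ^ (-s - 1) * kernelLM φ k (a * t) s := by
    rw [kernelLM, ← integral_const_mul]
    refine setIntegral_congr_fun measurableSet_Ioi fun u hu => ?_
    have hu' : 0 < u := hu
    simp only [kernelLMIntegrand, mul_div_cancel_left₀ u ha.ne']
    rw [Complex.ofReal_mul a u, Complex.mul_cpow_ofReal_nonneg ha.le hu'.le,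
      show t * (a * u) = a * t * u by ring]
    ring
  rw [h2, Complex.real_smul, Complex.cpow_sub _ _ ha', Complex.cpow_one] at h
  unfold kernelLM at h ⊢
  push_cast at h
  field_simp at h
  rw [← h]

theorem Lap_eq_kernelLM (φ : ℝ → ℂ) (t : ℝ) : Lap φ t = kernelLM φ (fun _ => 1) t (-1) := by
  simp [Lap, kernelLM, kernelLMIntegrand]

theorem LM_eq_kernelLM (φ : ℝ → ℂ) (s : ℂ) (t : ℝ) :
    LM φ s t = 1 / Complex.Gamma s * kernelLM φ (fun _ => 1) t (-s) := by
  simp [LM, kernelLM, kernelLMIntegrand]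

theorem MemDLi.comp_div {φ : ℝ → ℂ} (hφ : MemDLi φ) {a : ℝ} (ha : 0 < a) :
    MemDLi fun u => φ (u / a) := by
  obtain ⟨h, ψ, hψ, hmono, hle⟩ := hφ
  refine ⟨h.comp_div ha, fun u => ψ (u / a), hψ.comp_div ha, fun u hu v hv huv => ?_,
    fun u hu => hle _ (div_pos hu ha)⟩
  exact hmono (div_pos hu ha) (div_pos hv ha) (by gcongr)

theorem sum_exp_mul_bernSumKernel {m : ℕ} (hm : 0 < m) {u : ℝ} (hu : 0 < u) :
    ∑ j ∈ Finset.range m, Real.exp (-(j / m * u)) * bernSumKernel u =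
      m * bernSumKernel (u / m) := by
  have hm' : (0:ℝ) < m := by exact_mod_cast hm
  have h1 : ∀ j : ℕ, Real.exp (-(j / m * u)) = Real.exp (-(u / m)) ^ j := fun j => by
    rw [← Real.exp_nat_mul]; congr 1; ring
  have h2 : Real.exp (-u) = Real.exp (-(u / m)) ^ m := by
    rw [← Real.exp_nat_mul]; congr 1; field_simp
  have h3 := one_sub_exp_neg_pos hu
  have h4 := one_sub_exp_neg_pos (div_pos hu hm')
  have h5 := mul_neg_geom_sum (Real.exp (-(u / m))) m
  rw [← Finset.sum_mul]
  simp only [h1, bernSumKernel]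
  rw [← h2] at h5
  rw [← h5] at h3 ⊢
  have h6 := (pos_iff_pos_of_mul_pos h3).1 h4
  field_simp

theorem sum_kernelLM_bernSumKernel {φ : ℝ → ℂ} (hφ : MemDL φ) {m : ℕ} (hm : 0 < m) {s : ℂ}
    (hs : s.re < -1) {x : ℝ} (hx : 0 < x) :
    ∑ j ∈ Finset.range m, kernelLM (fun u => φ (u / m)) bernSumKernel ((x + j) / m) s =
      m * ((m : ℂ) ^ (-s) * kernelLM φ bernSumKernel x s) := by
  have hm' : (0:ℝ) < m := by exact_mod_cast hm
  have h := kernelLM_comp_div φ bernSumKernel (x / m) s hm'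
  rw [mul_div_cancel₀ x hm'.ne', Complex.ofReal_natCast] at h
  rw [← h]
  unfold kernelLM
  rw [← integral_finsetSum _ fun j _ => integrableOn_kernelLMIntegrand (hφ.comp_div hm')
    kernelBound_bernSumKernel
    (by positivity) (by simpa using hs.le), ← integral_const_mul]
  refine setIntegral_congr_fun measurableSet_Ioi fun u hu => ?_
  have hsum := congrArg (fun r : ℝ => (r : ℂ)) (sum_exp_mul_bernSumKernel hm hu)
  push_cast at hsum
  have e : ∀ j : ℕ, Complex.exp (-((x + j) / m * u : ℝ)) =
      Complex.exp (-(x / m * u : ℝ)) * Complex.exp (-(j / m * u)) := fun j => by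
    rw [← Complex.exp_add]; push_cast; ring_nf
  simp only [kernelLMIntegrand, e]
  calc _ = Complex.exp (-(x / m * u : ℝ)) * φ (u / m) * (u : ℂ) ^ (-s - 1) *
        ∑ j ∈ Finset.range m, Complex.exp (-(j / m * u)) * bernSumKernel u := by
        rw [Finset.mul_sum]; exact Finset.sum_congr rfl fun j _ => by ring
    _ = _ := by rw [hsum]; ring

namespace MemHwith

variable {f : ℂ → ℝ → ℂ} {φ : ℝ → ℂ}

theorem rescale (hf : MemHwith f φ) {m : ℕ} (hm : 0 < m) :
    MemHwith (fun σ t => (m : ℂ) ^ (-σ) * f σ (m * t)) (fun u => φ (u / m)) := by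
  have hm' : (0:ℝ) < m := by exact_mod_cast hm
  have hmc : (m : ℂ) ≠ 0 := by exact_mod_cast hm.ne'
  have hpos : ∀ {t : ℝ}, t ∈ Ioi (0:ℝ) → (m:ℝ) * t ∈ Ioi (0:ℝ) := fun ht => mul_pos hm' ht
  have hpow : Differentiable ℂ fun σ : ℂ => (m : ℂ) ^ (-σ) := fun σ =>
    differentiableAt_id.neg.const_cpow (Or.inl hmc)
  obtain ⟨h1, h2, h3, h4, h5, h6⟩ := hf
  have hd : ∀ (s : ℂ) {t : ℝ}, t ∈ Ioi (0:ℝ) →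
      HasDerivAt (fun t : ℝ => (m : ℂ) ^ (-s) * f s (m * t))
        ((m : ℂ) ^ (-s) * ((m : ℝ) • deriv (f s) (m * t))) t := fun s t ht => by
    have hg : HasDerivAt (fun t : ℝ => (m:ℝ) * t) m t := by
      simpa using (hasDerivAt_id t).const_mul (m:ℝ)
    exact ((h1 s _ (hpos ht)).hasDerivAt.scomp t hg).const_mul _
  refine ⟨fun s t ht => (hd s ht).differentiableAt,
    fun t ht => hpow.mul (h2 _ (hpos ht)), fun t ht => ?_, h4.comp_div hm',
    fun t ht => ?_, fun s hs t ht => ?_⟩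
  · simp only [fun s => (hd s ht).deriv]
    exact hpow.mul ((h3 _ (hpos ht)).const_smul (m:ℝ))
  · have h := kernelLM_comp_div φ (fun _ => 1) t (-1) hm'
    rw [Complex.ofReal_natCast] at h
    beta_reduce
    rw [Lap_eq_kernelLM, h, h5 _ (hpos ht), Lap_eq_kernelLM]
  · have h := kernelLM_comp_div φ (fun _ => 1) t (-s) hm'
    rw [Complex.ofReal_natCast] at h
    beta_reduce
    rw [LM_eq_kernelLM, h, h6 s hs _ (hpos ht), LM_eq_kernelLM]
    ring

theorem sum_Bop_rescale (hf : MemHwith f φ) {m : ℕ} (hm : 0 < m) (s : ℂ) {x : ℝ} (hx : 0 < x) :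
    (m : ℂ) ^ s * ∑ j ∈ Finset.range m,
        Bop 1 ((fun σ t => (m : ℂ) ^ (-σ) * f σ (m * t)) s) ((x + j) / m) =
      m * Bop 1 (f s) x := by
  have hm' : (0:ℝ) < m := by exact_mod_cast hm
  have hmc : (m : ℂ) ≠ 0 := by exact_mod_cast hm.ne'
  have hfm := hf.rescale hm
  have hxj : ∀ j : ℕ, 0 < (x + j) / m := fun j => by positivity
  refine eq_of_eqOn_re_lt (c := max (-1) (s.re + 1)) (le_max_left _ _)
    (F := fun s => (m : ℂ) ^ s * ∑ j ∈ Finset.range m,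
        Bop 1 ((fun σ t => (m : ℂ) ^ (-σ) * f σ (m * t)) s) ((x + j) / m))
    (G := fun s => m * Bop 1 (f s) x)
    (fun z _ => (differentiableAt_id.const_cpow (Or.inl hmc)).mul
      (DifferentiableAt.fun_sum fun j _ => hfm.differentiable_Bop (hxj j) z))
    (fun z _ => (hf.differentiable_Bop hx z).const_mul _) (fun z hz => ?_)
    (lt_max_of_lt_right (by linarith))
  rw [Finset.sum_congr rfl fun j _ => hfm.Bop_eq_of_re_lt_neg_one hz (hxj j),
    ← Finset.mul_sum, sum_kernelLM_bernSumKernel hf.memDL hm hz hx,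
    hf.Bop_eq_of_re_lt_neg_one hz hx, Complex.cpow_neg]
  have : (m : ℂ) ^ z ≠ 0 := by simp [Complex.cpow_eq_zero_iff, hmc]
  field_simp

end MemHwith

end LaplaceMellin

/-- weak renormalizability of Dirichlet-type series: with `f ∈ ℋ` (witness
`φ`, `φ(u) = o(u^γ)`, `Re γ > −1`), `t₀ > 0`, `s ≠ 0`, `m ≥ 1`,
`f^m(σ,t) = m^{−σ} f(σ, mt)`, and
`S_j(n) = (1/s)[(B f_s)(t₀+n) − m^s (B f^m_s)((t₀−1)/m + (n−j)/m + 1)]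
        − (1/s)[(B f_s)(t₀) − m^s (B f^m_s)((t₀−1)/m + 1)]`:
`f^m ∈ ℋ`, all Bernoulli series converge absolutely and locally uniformly,
(a) for `j < m` and `n = j + mk ≡ j (mod m)`, `S_j(n)` equals the difference of partial sums
`Σ_{i=1}^{n} f(s−1, t₀+i−1) − m^s Σ_{i=1}^{k} f^m(s−1, (t₀−1)/m + i)
 = Σ_{i=1}^{n} f(s−1, t₀+i−1) − m Σ_{i=1}^{k} f(s−1, t₀−1+mi)`, and
(b) the average `(1/m) Σ_{j=0}^{m−1} S_j(n)` is constant in `n`, equal to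
`−(1/s)[(B f_s)(t₀) − m^s (B f^m_s)((t₀−1)/m + 1)]`. -/
theorem stmt15 (f : ℂ → ℝ → ℂ) (φ : ℝ → ℂ) (hf : MemHwith f φ)
    (γ : ℂ) (hγ : -1 < γ.re) (hsm : SmallO φ γ)
    (t₀ : ℝ) (ht₀ : 0 < t₀) (s : ℂ) (hs : s ≠ 0) (m : ℕ) (hm : 1 ≤ m)
    (fm : ℂ → ℝ → ℂ) (hfm : fm = fun σ t => (m : ℂ) ^ (-σ) * f σ (m * t))
    (S : ℕ → ℕ → ℂ)
    (hS : S = fun (j n : ℕ) =>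
      (1 / s) * (Bop 1 (f s) (t₀ + n) -
          (m : ℂ) ^ s * Bop 1 (fm s) ((t₀ - 1) / m + ((n : ℝ) - (j : ℝ)) / m + 1)) -
      (1 / s) * (Bop 1 (f s) t₀ - (m : ℂ) ^ s * Bop 1 (fm s) ((t₀ - 1) / m + 1))) :
    MemH fm ∧
    ALUOn (BTerm 1 (f s)) (Ioi 0) ∧
    ALUOn (BTerm 1 (fm s)) (Ioi 0) ∧
    (∀ j < m, ∀ k : ℕ,
      S j (j + m * k) =
        (∑ i ∈ Finset.range (j + m * k), f (s - 1) (t₀ + i)) -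
          (m : ℂ) ^ s * ∑ i ∈ Finset.range k, fm (s - 1) ((t₀ - 1) / m + (i + 1)) ∧
      S j (j + m * k) =
        (∑ i ∈ Finset.range (j + m * k), f (s - 1) (t₀ + i)) -
          (m : ℂ) * ∑ i ∈ Finset.range k, f (s - 1) (t₀ - 1 + m * (i + 1))) ∧
    ∀ n : ℕ,
      (1 / (m : ℂ)) * ∑ j ∈ Finset.range m, S j n =
        -(1 / s) * (Bop 1 (f s) t₀ - (m : ℂ) ^ s * Bop 1 (fm s) ((t₀ - 1) / m + 1)) := by
  subst hfm hS
  have hm0 : 0 < m := hm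
  have hm' : (0:ℝ) < m := by exact_mod_cast hm0
  have hmc : (m : ℂ) ≠ 0 := by exact_mod_cast hm0.ne'
  have hfm := hf.rescale hm0
  have hy : 0 < (t₀ - 1) / m + 1 := by
    have h1 : (1:ℝ) ≤ m := by exact_mod_cast hm
    have h2 : (t₀ - 1) / m + 1 = (t₀ + (m - 1)) / m := by field_simp; ring
    rw [h2]
    exact div_pos (by linarith) hm'
  have hpow : ∀ k : ℕ, (m : ℂ) ^ s *
      ∑ i ∈ Finset.range k, (m : ℂ) ^ (-(s - 1)) * f (s - 1) (m * ((t₀ - 1) / m + (i + 1))) =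
      m * ∑ i ∈ Finset.range k, f (s - 1) (t₀ - 1 + m * (i + 1)) := fun k => by
    rw [← Finset.mul_sum, ← mul_assoc, ← Complex.cpow_add _ _ hmc,
      show s + -(s - 1) = 1 by ring, Complex.cpow_one]
    congr 1
    refine Finset.sum_congr rfl fun i _ => ?_
    rw [mul_add, mul_div_cancel₀ _ hm'.ne']
  refine ⟨⟨_, hfm⟩, hf.ALUOn_BTerm s, hfm.ALUOn_BTerm s, fun j _ k => ?_, fun n => ?_⟩
  · refine (fun h => ⟨h, h.trans (by rw [hpow k])⟩) ?_
    have h1 := hf.Bop_add_nat_sub s ht₀ (j + m * k)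
    have h2 := hfm.Bop_add_nat_sub s hy k
    have h3 : (t₀ - 1) / m + (((j + m * k : ℕ) : ℝ) - j) / m + 1 = (t₀ - 1) / m + 1 + k := by
      push_cast
      field_simp
      ring
    have h4 : ∀ i : ℕ, (t₀ - 1) / m + ((i : ℝ) + 1) = (t₀ - 1) / m + 1 + i := fun i => by ring
    simp only [h3, h4] at h1 h2 ⊢
    rw [eq_add_of_sub_eq h1, eq_add_of_sub_eq h2]
    field_simp
    ring
  · have h := hf.sum_Bop_rescale hm0 s (x := t₀ + n) (by positivity)
    rw [← Finset.sum_range_reflect] at h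
    have harg : ∀ j ∈ Finset.range m, (t₀ + n + ((m - 1 - j : ℕ) : ℝ)) / m =
        (t₀ - 1) / m + ((n : ℝ) - j) / m + 1 := fun j hj => by
      have hj' : j + 1 ≤ m := Finset.mem_range.1 hj
      rw [Nat.sub_sub, Nat.cast_sub (by omega)]
      push_cast
      field_simp
      ring
    rw [Finset.sum_congr rfl fun j hj => by rw [harg j hj]] at h
    simp only [Finset.sum_sub_distrib, ← Finset.mul_sum, Finset.sum_const, Finset.card_range,
      nsmul_eq_mul] at h ⊢
    rw [h]
    field_simp
    ring
end
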